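/- Let Ω ⊂ ℝ² be a bounded open set. Let K>1 and S₁,S₂ ∈ [1/K,K] with S₁S₂>1, and set S = (S₁+S₂+2S₁S₂)/(2+S₁+S₂) ∈ (1,K]. Let α ∈ (0,1), ε > 0, 0 < δ₀ < 2K/(K+1) − 2S/(S+1), and γ > 0. Then there exist a constant c > 1 depending only on K, S₁, S₂, δ₀, an exponent p ∈ (2K/(K+1) − δ₀, 2K/(K+1)], and a piecewise affine map f ∈ C^α(closure(Ω); ℝ²) such that: (i) f(x) = Jx = (x₁, −x₂) for every x ∈ ∂Ω; (ii) the C^α-Hölder seminorm of f − Jx on closure(Ω) is less than ε; (iii) dist(∇f(x), T₁ ∪ T₂) < γ for a.e. x ∈ Ω (∇f is defined a.e. via the affine pieces); (iv) for every t > c: c⁻¹·t^{−2K/(K+1)} < |{x ∈ Ω : |∇f(x)| > t}|/|Ω| < c·t^{−p}. In particular ∇f ∈ L^p_weak(Ω; ℝ^{2×2}), ∇f ∈ L¹(Ω), f ∈ W^{1,q} for every q < p, but ∫_Ω |∇f|^{2K/(K+1)} dx = ∞. -/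

import Mathlib

noncomputable section
open MeasureTheory Complex Real

/-- Points of the plane. -/
abbrev Pt := Fin 2 → ℝ

/-- Euclidean norm on the plane. -/
def e2norm (v : Pt) : ℝ := Real.sqrt (v 0 ^ 2 + v 1 ^ 2)

/-- `u ∈ L¹(Ω)` has weak gradient `g ∈ L¹(Ω;ℝ²)`:
`∫ u ∂_iφ = −∫ g_i φ` for every test function `φ` supported in `Ω`. -/
def HasWeakGradientOn (u : Pt → ℝ) (g : Pt → Pt) (Ω : Set Pt) : Prop :=
  ∀ φ : Pt → ℝ, ContDiff ℝ (⊤ : ℕ∞) φ → HasCompactSupport φ → tsupport φ ⊆ Ω →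
    ∀ i : Fin 2,
      ∫ x in Ω, u x * fderiv ℝ φ x (Pi.single i 1) = -∫ x in Ω, g x i * φ x

/-- 2×2 real matrices. -/
abbrev Mat2 := Matrix (Fin 2) (Fin 2) ℝ

/-- Hilbert–Schmidt norm of a 2×2 matrix. -/
def hsNormM (A : Mat2) : ℝ :=
  Real.sqrt (A 0 0 ^ 2 + A 0 1 ^ 2 + A 1 0 ^ 2 + A 1 1 ^ 2)

/-- The target set `T₁` in real coordinates: rows `(x, −y)` and `(y/S₁, x/K)`. -/
def T1M (K S1 : ℝ) : Set Mat2 := {A | ∃ x y : ℝ, A = !![x, -y; y / S1, x / K]}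

/-- The target set `T₂` in real coordinates: rows `(x, −y)` and `(S₂y, Kx)`. -/
def T2M (K S2 : ℝ) : Set Mat2 := {A | ∃ x y : ℝ, A = !![x, -y; S2 * y, K * x]}

/-- Distance of a matrix to a set of matrices in the Hilbert–Schmidt norm. -/
def setDistM (A : Mat2) (S : Set Mat2) : ℝ := sInf {r | ∃ Q ∈ S, r = hsNormM (A - Q)}

/-- `f` is piecewise affine on `Ω`, with (a.e.-defined) gradient `Df`:
there is a countable family of pairwise disjoint open subsets of `Ω`, with
boundaries of measure zero, covering `Ω` up to a null set, on each of which
`f` is affine with linear part `Df`. -/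
def PiecewiseAffineOn (f : Pt → Pt) (Df : Pt → Mat2) (Ω : Set Pt) : Prop :=
  ∃ U : ℕ → Set Pt,
    (∀ i, IsOpen (U i)) ∧ (∀ i, U i ⊆ Ω) ∧
    (∀ i j, i ≠ j → Disjoint (U i) (U j)) ∧
    (∀ i, volume (frontier (U i)) = 0) ∧
    volume (Ω \ ⋃ i, U i) = 0 ∧
    ∀ i, ∃ (M : Mat2) (b : Pt),
      (∀ x ∈ U i, f x = M.mulVec x + b) ∧ (∀ x ∈ U i, Df x = M)

/-! ### Kites -/

lemma volume_hyperplane_eq_zero (φ : Pt →ₗ[ℝ] ℝ) {v : Pt} (hv : φ v ≠ 0) (c : ℝ) :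
    volume {x : Pt | φ x = c} = 0 := by
  rcases Set.eq_empty_or_nonempty {x : Pt | φ x = c} with h | ⟨x₀, hx₀⟩
  · rw [h, measure_empty]
  have hx₀' : φ x₀ = c := hx₀
  have hset : {x : Pt | φ x = c} = (AffineSubspace.mk' x₀ (LinearMap.ker φ) : Set Pt) := by
    ext x
    simp [AffineSubspace.mem_mk', sub_eq_zero, hx₀']
  rw [hset]
  refine Measure.addHaar_affineSubspace _ _ fun htop => hv ?_
  have hmem : x₀ + v ∈ AffineSubspace.mk' x₀ (LinearMap.ker φ) := by
    rw [htop]; exact AffineSubspace.mem_top ℝ Pt _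
  simpa [AffineSubspace.mem_mk'] using hmem

lemma fin_two_add_one_ne (i : Fin 2) : i + 1 ≠ i := by fin_cases i <;> decide

lemma fin_two_eq_or (i j : Fin 2) : j = i ∨ j = i + 1 := by
  fin_cases i <;> fin_cases j <;> simp

/-- A concave piecewise affine function with apex `p` and height `r`: its slopes in the direction
`i` are `1` on the left of `p` and `-b` on the right, its slopes in the other direction `± η`. -/
def kite (i : Fin 2) (b η : ℝ) (p : Pt) (r : ℝ) (x : Pt) : ℝ :=
  r - max (-(x i - p i)) (b * (x i - p i)) - η * |x (i + 1) - p (i + 1)|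

/-- The part of the positivity set of a kite where the slope in the direction `i` is `1`. -/
def kiteLeft (i : Fin 2) (b η : ℝ) (p : Pt) (r : ℝ) : Set Pt :=
  {x | 0 < kite i b η p r x ∧ x i < p i ∧ x (i + 1) ≠ p (i + 1)}

/-- The part of the positivity set of a kite where the slope in the direction `i` is `-b`. -/
def kiteRight (i : Fin 2) (b η : ℝ) (p : Pt) (r : ℝ) : Set Pt :=
  {x | 0 < kite i b η p r x ∧ p i < x i ∧ x (i + 1) ≠ p (i + 1)}

section Kite

variable {i : Fin 2} {b η : ℝ} {p : Pt} {r : ℝ}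

lemma continuous_kite : Continuous (kite i b η p r) := by
  unfold kite; fun_prop

lemma abs_apply_sub_le (x y : Pt) (j : Fin 2) : |x j - y j| ≤ dist x y := by
  rw [← Real.dist_eq]; exact dist_le_pi_dist x y j

lemma kite_le_add (hb : 0 < b) (hη : 0 < η) (x y : Pt) :
    kite i b η p r x ≤ kite i b η p r y + (1 + b + η) * dist x y := by
  have h1 := abs_apply_sub_le x y i
  have h2 := abs_apply_sub_le x y (i + 1)
  have hd : 0 ≤ dist x y := dist_nonneg
  have h3 : |y (i + 1) - p (i + 1)| ≤ |x (i + 1) - p (i + 1)| + dist x y := by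
    have := abs_sub_abs_le_abs_sub (y (i + 1) - p (i + 1)) (x (i + 1) - p (i + 1))
    rw [show y (i + 1) - p (i + 1) - (x (i + 1) - p (i + 1)) = -(x (i + 1) - y (i + 1)) by ring,
      abs_neg] at this
    linarith
  have h4 := mul_le_mul_of_nonneg_left h3 hη.le
  have h5 : max (-(y i - p i)) (b * (y i - p i)) ≤
      max (-(x i - p i)) (b * (x i - p i)) + (1 + b) * dist x y := by
    have h6 := abs_le.1 h1
    have hbd : 0 ≤ b * dist x y := by positivity
    refine max_le ?_ ?_
    · have := le_max_left (-(x i - p i)) (b * (x i - p i))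
      linarith
    · have := le_max_right (-(x i - p i)) (b * (x i - p i))
      have h7 : b * (y i - x i) ≤ b * dist x y := mul_le_mul_of_nonneg_left (by linarith) hb.le
      linarith
  unfold kite
  linarith

lemma dist_le_of_kite_nonneg (hb : 0 < b) (hη : 0 < η) (hr : 0 ≤ r) {x : Pt}
    (hx : 0 ≤ kite i b η p r x) : dist x p ≤ (1 + 1 / b + 1 / η) * r := by
  unfold kite at hx
  have h1 := le_max_left (-(x i - p i)) (b * (x i - p i))
  have h2 := le_max_right (-(x i - p i)) (b * (x i - p i))
  have h0 : 0 ≤ max (-(x i - p i)) (b * (x i - p i)) := by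
    rcases le_total 0 (x i - p i) with h | h
    · exact le_trans (by positivity) h2
    · exact le_trans (by linarith) h1
  have h3 : 0 ≤ η * |x (i + 1) - p (i + 1)| := by positivity
  have hib : 0 ≤ 1 / b * r := by positivity
  have hie : 0 ≤ 1 / η * r := by positivity
  have h4 : x i - p i ≤ 1 / b * r := by
    rw [one_div, ← div_eq_inv_mul, le_div_iff₀ hb]; linarith
  have h5 : |x (i + 1) - p (i + 1)| ≤ 1 / η * r := by
    rw [one_div, ← div_eq_inv_mul, le_div_iff₀ hη]; linarith
  rw [dist_pi_le_iff (by positivity)]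
  intro j
  rw [Real.dist_eq]
  rcases fin_two_eq_or i j with rfl | rfl
  · rw [abs_le]; constructor <;> linarith
  · linarith

lemma kite_le : kite i b η p r p = r := by simp [kite]

lemma closedBall_subset_kite (hb : 0 < b) (hη : 0 < η) :
    Metric.closedBall p (r / (1 + b + η)) ⊆ {x | 0 ≤ kite i b η p r x} := by
  intro x hx
  have h := kite_le_add (i := i) (r := r) (p := p) hb hη p x
  rw [kite_le, dist_comm] at h
  have hx' : dist x p ≤ r / (1 + b + η) := hx
  rw [le_div_iff₀ (by positivity)] at hx'
  change 0 ≤ kite i b η p r x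
  linarith

lemma kite_le_height (hb : 0 < b) (hη : 0 < η) (x : Pt) : kite i b η p r x ≤ r := by
  have h3 : 0 ≤ η * |x (i + 1) - p (i + 1)| := by positivity
  have h0 : 0 ≤ max (-(x i - p i)) (b * (x i - p i)) := by
    rcases le_total 0 (x i - p i) with h | h
    · exact le_trans (by positivity) (le_max_right _ _)
    · exact le_trans (by linarith) (le_max_left _ _)
  unfold kite
  linarith

lemma isOpen_kiteLeft : IsOpen (kiteLeft i b η p r) := by
  have h1 : IsOpen {x : Pt | x (i + 1) ≠ p (i + 1)} :=
    isOpen_ne_fun (continuous_apply (i + 1)) continuous_const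
  exact (isOpen_lt continuous_const continuous_kite).inter
    ((isOpen_lt (continuous_apply i) continuous_const).inter h1)

lemma isOpen_kiteRight : IsOpen (kiteRight i b η p r) := by
  have h1 : IsOpen {x : Pt | x (i + 1) ≠ p (i + 1)} :=
    isOpen_ne_fun (continuous_apply (i + 1)) continuous_const
  exact (isOpen_lt continuous_const continuous_kite).inter
    ((isOpen_lt continuous_const (continuous_apply i)).inter h1)

lemma kite_left_right_null (hb : 0 < b) :
    volume ({x | 0 ≤ kite i b η p r x} \ (kiteLeft i b η p r ∪ kiteRight i b η p r)) = 0 := by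
  have hi : (Pi.single i (1 : ℝ) : Pt) (i + 1) = 0 := by simp [fin_two_add_one_ne i]
  have hline : ∀ s t c : ℝ, s ≠ 0 → volume {x : Pt | s * x i + t * x (i + 1) = c} = 0 := by
    intro s t c hs
    refine volume_hyperplane_eq_zero
      (s • LinearMap.proj i + t • LinearMap.proj (i + 1)) (v := Pi.single i 1) ?_ c
    simpa [fin_two_add_one_ne i] using hs
  have hcol : volume {x : Pt | x (i + 1) = p (i + 1)} = 0 :=
    volume_hyperplane_eq_zero (LinearMap.proj (i + 1)) (v := Pi.single (i + 1) 1)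
      (by simp) (p (i + 1))
  refine measure_mono_null (t := ({x : Pt | 1 * x i + 0 * x (i + 1) = p i} ∪
    {x : Pt | x (i + 1) = p (i + 1)}) ∪
    (({x : Pt | 1 * x i + (-η) * x (i + 1) = p i - r - η * p (i + 1)} ∪
      {x : Pt | 1 * x i + η * x (i + 1) = p i - r + η * p (i + 1)}) ∪
    ({x : Pt | b * x i + η * x (i + 1) = b * p i + r + η * p (i + 1)} ∪
      {x : Pt | b * x i + (-η) * x (i + 1) = b * p i + r - η * p (i + 1)}))) ?_ ?_
  · rintro x ⟨hx, hx'⟩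
    simp only [Set.mem_ofPred_eq] at hx
    by_contra hcon
    simp only [Set.mem_union, Set.mem_ofPred_eq, not_or, kiteLeft, kiteRight, not_and] at hcon hx'
    obtain ⟨⟨h1, h2⟩, ⟨h3, h4⟩, h5, h6⟩ := hcon
    have hpos : 0 < kite i b η p r x := by
      refine lt_of_le_of_ne hx fun h0 => ?_
      unfold kite at h0
      rcases le_total 0 (x i - p i) with h | h <;>
      rcases le_total 0 (x (i + 1) - p (i + 1)) with h' | h'
      · rw [abs_of_nonneg h', max_eq_right (by nlinarith)] at h0
        exact h5 (by linarith)
      · rw [abs_of_nonpos h', max_eq_right (by nlinarith)] at h0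
        exact h6 (by linarith)
      · rw [abs_of_nonneg h', max_eq_left (by nlinarith)] at h0
        exact h3 (by linarith)
      · rw [abs_of_nonpos h', max_eq_left (by nlinarith)] at h0
        exact h4 (by linarith)
    rcases lt_trichotomy (x i) (p i) with h | h | h
    · exact hx'.1 hpos h h2
    · exact h1 (by linarith)
    · exact hx'.2 hpos h h2
  · simp only [measure_union_null_iff]
    exact ⟨⟨hline _ _ _ one_ne_zero, hcol⟩, ⟨hline _ _ _ one_ne_zero, hline _ _ _ one_ne_zero⟩,
      hline _ _ _ hb.ne', hline _ _ _ hb.ne'⟩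

lemma volume_kiteLeft_eq_mul (hb : 0 < b) :
    volume (kiteLeft i b η p r) = ENNReal.ofReal b * volume (kiteRight i b η p r) := by
  have htrans : ∀ s : Set Pt, volume ((fun x => x + p) ⁻¹' s) = volume s := fun s =>
    measure_preimage_add_right volume p s
  let D : Matrix (Fin 2) (Fin 2) ℝ := Matrix.diagonal fun j => if j = i then -b else 1
  have hdet : LinearMap.det (Matrix.toLin' D) = -b := by
    rw [LinearMap.det_toLin', Matrix.det_diagonal, Fin.prod_univ_two]
    fin_cases i <;> simp
  have hpre : (fun x => x + p) ⁻¹' kiteRight i b η p r =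
      Matrix.toLin' D ⁻¹' ((fun x => x + p) ⁻¹' kiteLeft i b η p r) := by
    ext x
    have h1 : Matrix.toLin' D x i = -b * x i := by
      simp [D, Matrix.toLin'_apply, Matrix.mulVec_diagonal]
    have h2 : Matrix.toLin' D x (i + 1) = x (i + 1) := by
      simp [D, Matrix.toLin'_apply, Matrix.mulVec_diagonal, fin_two_add_one_ne i]
    simp only [Set.mem_preimage, kiteLeft, kiteRight, kite, Set.mem_ofPred_eq, Pi.add_apply, h1, h2,
      add_sub_cancel_right, ne_eq]
    have h4 : -b * x i + p i < p i ↔ p i < x i + p i := by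
      constructor <;> intro h <;> nlinarith
    rw [h4]
    refine and_congr_left fun h => ?_
    have hxi : 0 < x i := by linarith [h.1]
    rw [max_eq_right (by nlinarith), max_eq_left (by nlinarith [mul_pos hb hxi])]
    ring_nf
  rw [← htrans (kiteLeft i b η p r), ← htrans (kiteRight i b η p r), hpre,
    Measure.addHaar_preimage_linearMap volume (by rw [hdet]; linarith), hdet, ← mul_assoc,
    ← ENNReal.ofReal_mul hb.le, inv_neg, abs_neg, abs_of_pos (inv_pos.2 hb),
    mul_inv_cancel₀ hb.ne', ENNReal.ofReal_one, one_mul]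

lemma disjoint_kiteLeft_kiteRight : Disjoint (kiteLeft i b η p r) (kiteRight i b η p r) :=
  Set.disjoint_left.2 fun _ h h' => lt_asymm h.2.1 h'.2.1

lemma volume_kiteLeft (hb : 0 < b) :
    volume (kiteLeft i b η p r) =
      ENNReal.ofReal (b / (1 + b)) * volume {x | 0 ≤ kite i b η p r x} := by
  have hsub : kiteLeft i b η p r ∪ kiteRight i b η p r ⊆ {x | 0 ≤ kite i b η p r x} :=
    Set.union_subset (fun x hx => hx.1.le) (fun x hx => hx.1.le)
  have hsum : volume {x | 0 ≤ kite i b η p r x} =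
      volume (kiteLeft i b η p r) + volume (kiteRight i b η p r) := by
    rw [← measure_union disjoint_kiteLeft_kiteRight isOpen_kiteRight.measurableSet]
    refine le_antisymm ?_ (measure_mono hsub)
    calc volume {x | 0 ≤ kite i b η p r x}
        ≤ volume ((kiteLeft i b η p r ∪ kiteRight i b η p r) ∪
          ({x | 0 ≤ kite i b η p r x} \ (kiteLeft i b η p r ∪ kiteRight i b η p r))) :=
          measure_mono (by rw [Set.union_sdiff_self]; exact Set.subset_union_right)
      _ ≤ _ := (measure_union_le _ _).trans (by rw [kite_left_right_null hb, add_zero])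
  rw [hsum, volume_kiteLeft_eq_mul hb]
  conv_rhs => rw [← one_mul (volume (kiteRight i b η p r)), ← mul_assoc, mul_one, ← add_mul,
    ← mul_assoc, ← ENNReal.ofReal_one, ← ENNReal.ofReal_add hb.le zero_le_one,
    ← ENNReal.ofReal_mul (by positivity)]
  congr 2
  field_simp
  ring

end Kite

/-! ### Filling an open set with kites -/

lemma exists_kite_covering (i : Fin 2) {b η s : ℝ} (hb : 0 < b) (hη : 0 < η) (hs : 0 < s)
    {U : Set Pt} (hU : IsOpen U) :
    ∃ F : Set (Pt × ℝ), F.Countable ∧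
      (∀ a ∈ F, 0 < a.2 ∧ a.2 ≤ s ∧ {x | 0 ≤ kite i b η a.1 a.2 x} ⊆ U) ∧
      F.PairwiseDisjoint (fun a => {x | 0 ≤ kite i b η a.1 a.2 x}) ∧
      volume (U \ ⋃ a ∈ F, {x | 0 ≤ kite i b η a.1 a.2 x}) = 0 := by
  set R : ℝ := 1 + 1 / b + 1 / η with hR
  set L : ℝ := 1 + b + η with hL
  have hRpos : 0 < R := by positivity
  have hLpos : 0 < L := by positivity
  obtain ⟨F, hF, hFc, hFd, hF0⟩ := Vitali.exists_disjoint_covering_ae volume U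
    {a : Pt × ℝ | 0 < a.2 ∧ a.2 ≤ s ∧ {x | 0 ≤ kite i b η a.1 a.2 x} ⊆ U}
    (Real.toNNReal ((3 * R * L) ^ 2)) (fun a => R * a.2) (fun a => a.1)
    (fun a => {x | 0 ≤ kite i b η a.1 a.2 x})
    (fun a ha x hx => dist_le_of_kite_nonneg hb hη ha.1.le hx)
    (by
      intro a ha
      have ha0 : 0 < a.2 := ha.1
      refine le_trans ?_ (mul_le_mul_right (measure_mono (closedBall_subset_kite hb hη)) _)
      rw [Real.volume_pi_closedBall _ (by positivity), Real.volume_pi_closedBall _ (by positivity)]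
      change _ ≤ ENNReal.ofReal _ * _
      rw [← ENNReal.ofReal_mul (by positivity)]
      refine ENNReal.ofReal_le_ofReal (le_of_eq ?_)
      rw [Fintype.card_fin, ← mul_pow, ← hL]
      congr 1
      field_simp)
    (by
      intro a ha
      refine ⟨a.1, interior_mono (closedBall_subset_kite hb hη) ?_⟩
      exact Metric.ball_subset_interior_closedBall
        (Metric.mem_ball_self (div_pos ha.1 (by positivity))))
    (fun a _ => isClosed_le continuous_const continuous_kite)
    (by
      intro x hx ε hε
      obtain ⟨ρ, hρ, hρU⟩ := Metric.nhds_basis_closedBall.mem_iff.1 (hU.mem_nhds hx)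
      have hpos : 0 < min s (min (ρ / R) (ε / R)) := by positivity
      have h1 : min s (min (ρ / R) (ε / R)) ≤ ρ / R := (min_le_right _ _).trans (min_le_left _ _)
      have h2 : min s (min (ρ / R) (ε / R)) ≤ ε / R := (min_le_right _ _).trans (min_le_right _ _)
      rw [le_div_iff₀ hRpos, mul_comm] at h1 h2
      refine ⟨(x, min s (min (ρ / R) (ε / R))),
          ⟨hpos, min_le_left _ _, fun y hy => hρU ?_⟩, h2, rfl⟩
      exact (dist_le_of_kite_nonneg hb hη hpos.le hy).trans h1)
  exact ⟨F, hFc, hF, hFd, hF0⟩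

/-- Every open set carries a small Lipschitz function vanishing outside of it which is almost
everywhere locally affine, with slope in the direction `i` equal to `1` on a fraction `b / (1 + b)`
of the set and to `-b` on the rest. -/
lemma exists_sawtooth (i : Fin 2) {b η s : ℝ} (hb : 0 < b) (hη : 0 < η) (hs : 0 < s)
    {U : Set Pt} (hU : IsOpen U) :
    ∃ (u : Pt → ℝ) (P N : Set Pt), IsOpen P ∧ IsOpen N ∧ P ⊆ U ∧ N ⊆ U ∧ Disjoint P N ∧
      volume (U \ (P ∪ N)) = 0 ∧ volume P = ENNReal.ofReal (b / (1 + b)) * volume U ∧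
      (∀ x, 0 ≤ u x) ∧ (∀ x, u x ≤ s) ∧ (∀ x, x ∉ U → u x = 0) ∧
      (∀ x y, |u x - u y| ≤ (1 + b + η) * dist x y) ∧
      (∀ x ∈ P, ∃ σ c : ℝ, |σ| ≤ η ∧ ∀ᶠ y in nhds x, u y = y i + σ * y (i + 1) + c) ∧
      (∀ x ∈ N, ∃ σ c : ℝ, |σ| ≤ η ∧ ∀ᶠ y in nhds x, u y = -b * y i + σ * y (i + 1) + c) := by
  obtain ⟨F, hFc, hF, hFd, hF0⟩ := exists_kite_covering i hb hη hs hU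
  have hLpos : 0 < 1 + b + η := by positivity
  set u : Pt → ℝ := fun x => ⨆ a : F, max (kite i b η a.1.1 a.1.2 x) 0 with hu
  have hbdd : ∀ x, BddAbove (Set.range fun a : F => max (kite i b η a.1.1 a.1.2 x) 0) := by
    rintro x
    refine ⟨s, ?_⟩
    rintro _ ⟨a, rfl⟩
    exact max_le ((kite_le_height hb hη x).trans (hF a a.2).2.1) hs.le
  have hu0 : ∀ x, 0 ≤ u x := fun x => Real.iSup_nonneg fun a => le_max_right _ _
  have hlip : ∀ x y, u x ≤ u y + (1 + b + η) * dist x y := by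
    intro x y
    have hd : 0 ≤ (1 + b + η) * dist x y := by positivity
    refine Real.iSup_le (fun a => ?_) (add_nonneg (hu0 y) hd)
    refine max_le ?_ (add_nonneg (hu0 y) hd)
    have h1 := kite_le_add (i := i) (p := a.1.1) (r := a.1.2) hb hη x y
    have h2 : max (kite i b η a.1.1 a.1.2 y) 0 ≤ u y := le_ciSup (hbdd y) a
    have h3 := le_max_left (kite i b η a.1.1 a.1.2 y) 0
    linarith
  have hueq : ∀ a ∈ F, ∀ x, 0 ≤ kite i b η a.1 a.2 x → u x = kite i b η a.1 a.2 x := by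
    intro a ha x hx
    refine le_antisymm (Real.iSup_le (fun a' => ?_) hx) ?_
    · by_cases h : a'.1 = a
      · rw [h]; exact max_le le_rfl hx
      · refine max_le ?_ hx
        by_contra hcon
        have hx' : 0 ≤ kite i b η a'.1.1 a'.1.2 x := by linarith
        exact Set.disjoint_left.1 (hFd a'.2 ha h) hx' hx
    · exact (le_max_left _ 0).trans (le_ciSup (hbdd x) ⟨a, ha⟩)
  have hloc : ∀ a ∈ F, ∀ x, 0 < kite i b η a.1 a.2 x → x (i + 1) ≠ a.1 (i + 1) →
      ∃ σ c : ℝ, |σ| ≤ η ∧ ∀ᶠ y in nhds x,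
        u y = -max (-(y i - a.1 i)) (b * (y i - a.1 i)) + σ * y (i + 1) + c := by
    intro a ha x hx hne
    have hev := continuous_kite.continuousAt.eventually_const_lt hx
    rcases lt_or_gt_of_ne hne with h | h
    · refine ⟨η, a.2 - η * a.1 (i + 1), (abs_of_pos hη).le, ?_⟩
      filter_upwards [hev, (continuous_apply (i + 1)).continuousAt.eventually_lt_const h]
        with y hy hy'
      rw [hueq a ha y hy.le, kite, abs_of_neg (by linarith)]
      ring
    · refine ⟨-η, a.2 + η * a.1 (i + 1), by rw [abs_neg, abs_of_pos hη], ?_⟩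
      filter_upwards [hev, (continuous_apply (i + 1)).continuousAt.eventually_const_lt h]
        with y hy hy'
      rw [hueq a ha y hy.le, kite, abs_of_pos (by linarith)]
      ring
  have hleft : ∀ a : Pt × ℝ, kiteLeft i b η a.1 a.2 ⊆ {x | 0 ≤ kite i b η a.1 a.2 x} :=
    fun a x hx => hx.1.le
  have hright : ∀ a : Pt × ℝ, kiteRight i b η a.1 a.2 ⊆ {x | 0 ≤ kite i b η a.1 a.2 x} :=
    fun a x hx => hx.1.le
  have hBU : (⋃ a ∈ F, {x | 0 ≤ kite i b η a.1 a.2 x}) ⊆ U :=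
    Set.iUnion₂_subset fun a ha => (hF a ha).2.2
  have hBm : ∀ a ∈ F, MeasurableSet {x | 0 ≤ kite i b η a.1 a.2 x} := fun a _ =>
    (isClosed_le continuous_const continuous_kite).measurableSet
  refine ⟨u, ⋃ a ∈ F, kiteLeft i b η a.1 a.2, ⋃ a ∈ F, kiteRight i b η a.1 a.2,
    isOpen_biUnion fun a _ => isOpen_kiteLeft, isOpen_biUnion fun a _ => isOpen_kiteRight,
    (Set.iUnion₂_mono fun a _ => hleft a).trans hBU,
    (Set.iUnion₂_mono fun a _ => hright a).trans hBU, ?_, ?_, ?_, hu0, ?_, ?_, ?_, ?_, ?_⟩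
  · simp only [Set.disjoint_iUnion_left, Set.disjoint_iUnion_right]
    intro a ha a' ha'
    by_cases h : a' = a
    · rw [h]; exact disjoint_kiteLeft_kiteRight
    · exact (hFd ha' ha h).mono (hleft a') (hright a)
  · refine measure_mono_null (t := (U \ ⋃ a ∈ F, {x | 0 ≤ kite i b η a.1 a.2 x}) ∪
      ⋃ a ∈ F, ({x | 0 ≤ kite i b η a.1 a.2 x} \
        (kiteLeft i b η a.1 a.2 ∪ kiteRight i b η a.1 a.2))) ?_ ?_
    · rintro x ⟨hxU, hx⟩
      simp only [Set.mem_union, Set.mem_iUnion, not_or, not_exists] at hx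
      by_cases hxB : x ∈ ⋃ a ∈ F, {x | 0 ≤ kite i b η a.1 a.2 x}
      · right
        simp only [Set.mem_iUnion] at hxB ⊢
        obtain ⟨a, ha, hxa⟩ := hxB
        exact ⟨a, ha, hxa, fun h => h.elim (hx.1 a ha) (hx.2 a ha)⟩
      · exact Or.inl ⟨hxU, hxB⟩
    · rw [measure_union_null_iff, measure_biUnion_null_iff hFc]
      exact ⟨hF0, fun a _ => kite_left_right_null hb⟩
  · have hvU : volume U = volume (⋃ a ∈ F, {x | 0 ≤ kite i b η a.1 a.2 x}) := by
      refine le_antisymm ?_ (measure_mono hBU)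
      refine (measure_mono (t := (⋃ a ∈ F, {x | 0 ≤ kite i b η a.1 a.2 x}) ∪
        (U \ ⋃ a ∈ F, {x | 0 ≤ kite i b η a.1 a.2 x})) ?_).trans ?_
      · rw [Set.union_sdiff_self]; exact Set.subset_union_right
      · exact (measure_union_le _ _).trans (by rw [hF0, add_zero])
    rw [hvU, measure_biUnion hFc hFd hBm, measure_biUnion hFc
      (hFd.mono_on fun a _ => hleft a) (fun a _ => isOpen_kiteLeft.measurableSet),
      ← ENNReal.tsum_mul_left]
    exact tsum_congr fun a => volume_kiteLeft hb
  · exact fun x => Real.iSup_le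
      (fun a => max_le ((kite_le_height hb hη x).trans (hF a a.2).2.1) hs.le) hs.le
  · intro x hx
    refine le_antisymm (Real.iSup_le (fun a => max_le ?_ le_rfl) le_rfl) (hu0 x)
    by_contra hcon
    exact hx ((hF a a.2).2.2 (show 0 ≤ kite i b η a.1.1 a.1.2 x by linarith))
  · intro x y
    rw [abs_le]
    have h1 := hlip x y
    have h2 := hlip y x
    rw [dist_comm] at h2
    constructor <;> linarith
  · intro x hx
    simp only [Set.mem_iUnion] at hx
    obtain ⟨a, ha, hxa, hxi, hne⟩ := hx
    obtain ⟨σ, c, hσ, hev⟩ := hloc a ha x hxa hne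
    refine ⟨σ, c - a.1 i, hσ, ?_⟩
    filter_upwards [hev, (continuous_apply i).continuousAt.eventually_lt_const hxi] with y hy hyi
    rw [hy, max_eq_left (by nlinarith)]
    ring
  · intro x hx
    simp only [Set.mem_iUnion] at hx
    obtain ⟨a, ha, hxa, hxi, hne⟩ := hx
    obtain ⟨σ, c, hσ, hev⟩ := hloc a ha x hxa hne
    refine ⟨σ, c + b * a.1 i, hσ, ?_⟩
    filter_upwards [hev, (continuous_apply i).continuousAt.eventually_const_lt hxi] with y hy hyi
    rw [hy, max_eq_right (by nlinarith)]
    ring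

/-! ### Locally affine maps -/

/-- Near `x`, the map `f` is affine with linear part `M`. -/
def LocallyAffineAt (f : Pt → Pt) (M : Mat2) (x : Pt) : Prop :=
  ∃ c : Pt, ∀ᶠ y in nhds x, f y = M.mulVec y + c

/-- The Jacobian matrix of `f` at `x`. -/
def jacobian (f : Pt → Pt) (x : Pt) : Mat2 :=
  Matrix.of fun k l => fderiv ℝ f x (Pi.single l 1) k

lemma LocallyAffineAt.jacobian_eq {f : Pt → Pt} {M : Mat2} {x : Pt} (h : LocallyAffineAt f M x) :
    jacobian f x = M := by
  obtain ⟨c, hc⟩ := h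
  have hd : HasFDerivAt (fun y : Pt => M.mulVec y + c)
      (LinearMap.toContinuousLinearMap (Matrix.toLin' M)) x :=
    ((LinearMap.toContinuousLinearMap (Matrix.toLin' M)).hasFDerivAt (x := x)).add_const c
  have hf := (hd.congr_of_eventuallyEq hc).fderiv
  ext k l
  simp [jacobian, hf]

lemma LocallyAffineAt.add {f g : Pt → Pt} {M M' : Mat2} {x : Pt} (hf : LocallyAffineAt f M x)
    (hg : LocallyAffineAt g M' x) : LocallyAffineAt (fun y => f y + g y) (M + M') x := by
  obtain ⟨c, hc⟩ := hf
  obtain ⟨c', hc'⟩ := hg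
  refine ⟨c + c', ?_⟩
  filter_upwards [hc, hc'] with y hy hy'
  rw [hy, hy', Matrix.add_mulVec]
  abel

lemma LocallyAffineAt.sum {ι : Type*} {s : Finset ι} {f : ι → Pt → Pt} {M : ι → Mat2} {x : Pt}
    (h : ∀ a ∈ s, LocallyAffineAt (f a) (M a) x) :
    LocallyAffineAt (fun y => ∑ a ∈ s, f a y) (∑ a ∈ s, M a) x := by
  choose! c hc using h
  refine ⟨∑ a ∈ s, c a, ?_⟩
  filter_upwards [(Filter.eventually_all_finset s).2 hc] with y hy
  rw [Matrix.sum_mulVec, ← Finset.sum_add_distrib]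
  exact Finset.sum_congr rfl hy

lemma locallyAffineAt_single {u : Pt → ℝ} {i : Fin 2} {s σ c : ℝ} (τ : ℝ) {x : Pt}
    (h : ∀ᶠ y in nhds x, u y = s * y i + σ * y (i + 1) + c) :
    LocallyAffineAt (fun y => Pi.single i (τ * u y))
      (Matrix.single i i (τ * s) + Matrix.single i (i + 1) (τ * σ)) x := by
  refine ⟨Pi.single i (τ * c), ?_⟩
  filter_upwards [h] with y hy
  rw [hy, Matrix.add_mulVec]
  ext k
  rcases fin_two_eq_or i k with rfl | rfl
  · simp [Matrix.single_mulVec]; ring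
  · simp [Matrix.single_mulVec]

lemma measurable_hsNormM_jacobian (f : Pt → Pt) : Measurable fun x => hsNormM (jacobian f x) := by
  have h : ∀ k l, Measurable fun x => jacobian f x k l := fun k l =>
    (measurable_pi_apply k).comp (measurable_fderiv_apply_const ℝ f (Pi.single l 1))
  unfold hsNormM
  exact (((((h 0 0).pow_const 2).add ((h 0 1).pow_const 2)).add ((h 1 0).pow_const 2)).add
    ((h 1 1).pow_const 2)).sqrt

lemma piecewiseAffineOn_of_locallyAffineAt {f : Pt → Pt} {Ω G : Set Pt} (hG : IsOpen G)
    (hGΩ : G ⊆ Ω) (hnull : volume (Ω \ G) = 0) (h : ∀ x ∈ G, ∃ M, LocallyAffineAt f M x) :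
    PiecewiseAffineOn f (jacobian f) Ω := by
  obtain ⟨F, hF, hFc, hFd, hF0⟩ := Vitali.exists_disjoint_covering_ae volume G
    {a : Pt × ℝ | 0 < a.2 ∧ Metric.closedBall a.1 a.2 ⊆ G ∧ ∃ (M : Mat2) (c : Pt),
      ∀ y ∈ Metric.closedBall a.1 a.2, f y = M.mulVec y + c}
    9 (fun a => a.2) (fun a => a.1) (fun a => Metric.closedBall a.1 a.2)
    (fun a _ => subset_rfl)
    (by
      intro a ha
      rw [Real.volume_pi_closedBall _ (by linarith [ha.1]), Real.volume_pi_closedBall _ ha.1.le]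
      rw [show ((9 : NNReal) : ENNReal) = ENNReal.ofReal 9 by simp,
        ← ENNReal.ofReal_mul (by norm_num)]
      refine ENNReal.ofReal_le_ofReal (le_of_eq ?_)
      rw [Fintype.card_fin]
      ring)
    (fun a ha => ⟨a.1, Metric.ball_subset_interior_closedBall (Metric.mem_ball_self ha.1)⟩)
    (fun a _ => Metric.isClosed_closedBall)
    (by
      intro x hx ε hε
      obtain ⟨M, c, hc⟩ := h x hx
      obtain ⟨ρ, hρ, hρG⟩ := Metric.nhds_basis_closedBall.mem_iff.1
        (Filter.inter_mem (hG.mem_nhds hx) hc)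
      have hsub : Metric.closedBall x (min ρ ε) ⊆ Metric.closedBall x ρ :=
        Metric.closedBall_subset_closedBall (min_le_left _ _)
      exact ⟨(x, min ρ ε), ⟨lt_min hρ hε, fun y hy => (hρG (hsub hy)).1, M, c,
        fun y hy => (hρG (hsub hy)).2⟩, min_le_right _ _, rfl⟩)
  have := hFc.to_subtype
  have : Encodable F := Encodable.ofCountable F
  have hdisj : Pairwise (Function.onFun Disjoint fun a : F => Metric.ball a.1.1 a.1.2) := by
    intro a a' haa'
    exact (hFd a.2 a'.2 (fun hcon => haa' (Subtype.ext hcon))).mono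
      Metric.ball_subset_closedBall Metric.ball_subset_closedBall
  refine ⟨fun n => ⋃ a ∈ Encodable.decode₂ F n, Metric.ball a.1.1 a.1.2, fun n => ?_, fun n => ?_,
    fun m n hmn => Encodable.iUnion_decode₂_disjoint_on hdisj hmn, fun n => ?_, ?_, fun n => ?_⟩
  · exact Encodable.iUnion_decode₂_cases (C := IsOpen) isOpen_empty fun _ => Metric.isOpen_ball
  · exact Encodable.iUnion_decode₂_cases (C := fun s => s ⊆ Ω) (Set.empty_subset _)
      fun a => (Metric.ball_subset_closedBall.trans (hF a.2).2.1).trans hGΩ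
  · exact Encodable.iUnion_decode₂_cases (C := fun s : Set Pt => volume (frontier s) = 0) (by simp)
      fun a => measure_mono_null Metric.frontier_ball_subset_sphere
        (Measure.addHaar_sphere_of_ne_zero volume _ (hF a.2).1.ne')
  · rw [Encodable.iUnion_decode₂]
    refine measure_mono_null (t := (Ω \ G) ∪ (G \ ⋃ a ∈ F, Metric.closedBall a.1 a.2) ∪
      ⋃ a ∈ F, Metric.sphere a.1 a.2) ?_ ?_
    · rintro x ⟨hxΩ, hx⟩
      simp only [Set.mem_union, Set.mem_sdiff, Set.mem_iUnion, not_exists] at hx ⊢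
      by_cases hxG : x ∈ G
      · by_cases hxF : ∃ a, ∃ (_ : a ∈ F), x ∈ Metric.closedBall a.1 a.2
        · obtain ⟨a, ha, hxa⟩ := hxF
          refine Or.inr ⟨a, ha, le_antisymm hxa (not_lt.1 fun hcon => hx ⟨a, ha⟩ hcon)⟩
        · push Not at hxF
          exact Or.inl (Or.inr ⟨hxG, hxF⟩)
      · exact Or.inl (Or.inl ⟨hxΩ, hxG⟩)
    · simp only [measure_union_null_iff, measure_biUnion_null_iff hFc]
      exact ⟨⟨hnull, hF0⟩, fun a ha => Measure.addHaar_sphere_of_ne_zero volume _ (hF ha).1.ne'⟩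
  · refine Encodable.iUnion_decode₂_cases (C := fun s => ∃ (M : Mat2) (b : Pt),
      (∀ x ∈ s, f x = M.mulVec x + b) ∧ ∀ x ∈ s, jacobian f x = M) ⟨0, 0, by simp, by simp⟩ ?_
    intro a
    obtain ⟨-, -, M, c, hc⟩ := hF a.2
    refine ⟨M, c, fun x hx => hc x (Metric.ball_subset_closedBall hx), fun x hx => ?_⟩
    refine LocallyAffineAt.jacobian_eq ⟨c, ?_⟩
    filter_upwards [Metric.isOpen_ball.mem_nhds hx] with y hy
      using hc y (Metric.ball_subset_closedBall hy)

/-! ### Superposition of sawtooth functions -/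

lemma e2norm_nonneg (v : Pt) : 0 ≤ e2norm v := Real.sqrt_nonneg _

lemma dist_le_e2norm_sub (x y : Pt) : dist x y ≤ e2norm (x - y) := by
  rw [dist_pi_le_iff (e2norm_nonneg _)]
  intro k
  rw [Real.dist_eq, e2norm]
  refine Real.abs_le_sqrt ?_
  fin_cases k
  · simpa using sq_nonneg (x 1 - y 1)
  · simpa using sq_nonneg (x 0 - y 0)

lemma e2norm_le_two_mul_norm (v : Pt) : e2norm v ≤ 2 * ‖v‖ := by
  have h0 := norm_le_pi_norm v 0
  have h1 := norm_le_pi_norm v 1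
  rw [Real.norm_eq_abs] at h0 h1
  refine Real.sqrt_le_iff.2 ⟨by positivity, ?_⟩
  nlinarith [sq_abs (v 0), sq_abs (v 1), abs_nonneg (v 0), abs_nonneg (v 1)]

lemma hsNormM_nonneg (A : Mat2) : 0 ≤ hsNormM A := Real.sqrt_nonneg _

lemma hsNormM_le_two_mul {A : Mat2} {e : ℝ} (h : ∀ k l, |A k l| ≤ e) : hsNormM A ≤ 2 * e := by
  have he : 0 ≤ e := (abs_nonneg _).trans (h 0 0)
  have hsq : ∀ k l, A k l ^ 2 ≤ e ^ 2 := fun k l =>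
    sq_le_sq' (abs_le.1 (h k l)).1 (abs_le.1 (h k l)).2
  refine Real.sqrt_le_iff.2 ⟨by positivity, ?_⟩
  nlinarith [hsq 0 0, hsq 0 1, hsq 1 0, hsq 1 1]

lemma exists_holder_height {α L e s₀ : ℝ} (hα : α ∈ Set.Ioo (0 : ℝ) 1) (hL : 0 < L) (he : 0 < e)
    (hs₀ : 0 < s₀) : ∃ s : ℝ, 0 < s ∧ s ≤ s₀ ∧ L ^ α * s ^ (1 - α) ≤ e := by
  have hα' : 0 < 1 - α := by linarith [hα.2]
  have hLα : 0 < L ^ α := Real.rpow_pos_of_pos hL α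
  have hpos : 0 < (e / L ^ α) ^ (1 / (1 - α)) := Real.rpow_pos_of_pos (by positivity) _
  refine ⟨min s₀ ((e / L ^ α) ^ (1 / (1 - α))), lt_min hs₀ hpos, min_le_left _ _, ?_⟩
  have h1 : (min s₀ ((e / L ^ α) ^ (1 / (1 - α)))) ^ (1 - α) ≤ e / L ^ α := by
    refine (Real.rpow_le_rpow (lt_min hs₀ hpos).le (min_le_right _ _) hα'.le).trans (le_of_eq ?_)
    rw [← Real.rpow_mul (by positivity), one_div_mul_cancel hα'.ne', Real.rpow_one]
  calc _ ≤ L ^ α * (e / L ^ α) := mul_le_mul_of_nonneg_left h1 hLα.le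
    _ = e := by field_simp

lemma le_rpow_of_le_of_le {α L e s t D : ℝ} (hα : α ∈ Set.Ioo (0 : ℝ) 1) (hL : 0 < L)
    (hLs : L ^ α * s ^ (1 - α) ≤ e) (ht : 0 ≤ t) (hts : t ≤ s) (htD : t ≤ L * D) (hD : 0 ≤ D) :
    t ≤ e * D ^ α := by
  have hα' : 0 < 1 - α := by linarith [hα.2]
  have hDα : 0 ≤ D ^ α := Real.rpow_nonneg hD α
  calc t = t ^ α * t ^ (1 - α) := by
        rw [← Real.rpow_add_of_nonneg ht hα.1.le hα'.le, add_sub_cancel, Real.rpow_one]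
    _ ≤ (L * D) ^ α * s ^ (1 - α) := by
        refine mul_le_mul (Real.rpow_le_rpow ht htD hα.1.le) (Real.rpow_le_rpow ht hts hα'.le)
          (Real.rpow_nonneg ht _) (Real.rpow_nonneg (by positivity) _)
    _ = L ^ α * s ^ (1 - α) * D ^ α := by rw [Real.mul_rpow hL.le hD]; ring
    _ ≤ e * D ^ α := mul_le_mul_of_nonneg_right hLs hDα

lemma hasSum_div_two_pow (a : ℝ) (k : ℕ) :
    HasSum (fun n : ℕ => a / 2 ^ (n + k + 1)) (a / 2 ^ k) := by
  have h := hasSum_geometric_two' (a / 2 ^ k)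
  convert h using 2 with n
  rw [pow_add, pow_add]
  field_simp

/-- The conjugation matrix `J`. -/
def conjMat : Mat2 := !![1, 0; 0, -1]

lemma conjMat_mulVec (x : Pt) : conjMat.mulVec x = ![x 0, -x 1] := by
  ext k
  fin_cases k <;> simp [conjMat, Matrix.mulVec, dotProduct]

/-- The infinite superposition of sawtooth functions, each of which lives on the set `V n` where
all the previous ones have slope of modulus one: after `n` steps the gradient is, up to a small
error, `J + ∑_{m<n} τ m • E_{d m, d m}` on `V n`, and on the part `W n` of `V n` where the
`n`-th function has slope `-b n`, the gradient of the sum is final. -/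
lemma exists_superposition (d : ℕ → Fin 2) {τ b : ℕ → ℝ} (hτ : ∀ n, |τ n| = 1) (hb : ∀ n, 0 < b n)
    {Ω : Set Pt} (hΩ : IsOpen Ω) {α ε γ : ℝ} (hα : α ∈ Set.Ioo (0 : ℝ) 1) (hε : 0 < ε)
    (hγ : 0 < γ) :
    ∃ (f : Pt → Pt) (V W : ℕ → Set Pt), (∀ x, x ∉ Ω → f x = conjMat.mulVec x) ∧
      (∀ x y, e2norm ((f x - conjMat.mulVec x) - (f y - conjMat.mulVec y)) ≤
        ε / 2 * e2norm (x - y) ^ α) ∧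
      V 0 = Ω ∧ (∀ n, IsOpen (V n)) ∧ Antitone V ∧
      (∀ n, volume (V (n + 1)) = ENNReal.ofReal (b n / (1 + b n)) * volume (V n)) ∧
      (∀ n, IsOpen (W n)) ∧ (∀ n, W n ⊆ V n) ∧ (∀ n, Disjoint (V (n + 1)) (W n)) ∧
      (∀ n, volume (V n \ (V (n + 1) ∪ W n)) = 0) ∧
      ∀ n, ∀ x ∈ W n, ∃ M, LocallyAffineAt f M x ∧
        hsNormM (M - (conjMat + ∑ m ∈ Finset.range n, Matrix.single (d m) (d m) (τ m) -
          Matrix.single (d n) (d n) (τ n * b n))) < γ := by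
  have hη : ∀ n : ℕ, 0 < γ / 2 ^ (n + 2 + 1) := fun n => by positivity
  have hL : ∀ n : ℕ, 0 < 1 + b n + γ / 2 ^ (n + 2 + 1) := fun n => by
    have := hb n
    have := hη n
    positivity
  have hheight : ∀ n : ℕ, ∃ s : ℝ, 0 < s ∧ s ≤ 1 / 2 ^ (n + 0 + 1) ∧
      (1 + b n + γ / 2 ^ (n + 2 + 1)) ^ α * s ^ (1 - α) ≤ ε / 2 ^ (n + 2 + 1) := fun n =>
    exists_holder_height hα (hL n) (by positivity) (by positivity)
  choose s hs hs1 hsL using hheight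
  have hstep : ∀ (n : ℕ) (U : Set Pt), ∃ (u : Pt → ℝ) (P N : Set Pt), IsOpen U → _ :=
    fun n U => by
      by_cases hU : IsOpen U
      · obtain ⟨u, P, N, h⟩ := exists_sawtooth (d n) (hb n) (hη n) (hs n) hU
        exact ⟨u, P, N, fun _ => h⟩
      · exact ⟨0, ∅, ∅, fun h => absurd h hU⟩
  choose u P N hstep using hstep
  let V : ℕ → Set Pt := fun n => Nat.rec Ω (fun n U => P n U) n
  have hVsucc : ∀ n, V (n + 1) = P n (V n) := fun n => rfl
  have hV : ∀ n, IsOpen (V n) := by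
    intro n
    induction n with
    | zero => exact hΩ
    | succ n ih => exact (hstep n (V n) ih).1
  have H := fun n => hstep n (V n) (hV n)
  simp only [← hVsucc] at H
  set v : ℕ → Pt → ℝ := fun n => u n (V n) with hv
  set W : ℕ → Set Pt := fun n => N n (V n) with hW
  have hanti : Antitone V := antitone_nat_of_succ_le fun n => (H n).2.2.1
  have hv0 : ∀ n x, x ∉ V n → v n x = 0 := fun n => (H n).2.2.2.2.2.2.2.2.2.1
  have hvnonneg : ∀ n x, 0 ≤ v n x := fun n => (H n).2.2.2.2.2.2.2.1
  have hvle : ∀ n x, v n x ≤ s n := fun n => (H n).2.2.2.2.2.2.2.2.1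
  have hvlip : ∀ n x y, |v n x - v n y| ≤ (1 + b n + γ / 2 ^ (n + 2 + 1)) * dist x y :=
    fun n => (H n).2.2.2.2.2.2.2.2.2.2.1
  have hvgood := fun n => (H n).2.2.2.2.2.2.2.2.2.2.2.1
  have hvbad := fun n => (H n).2.2.2.2.2.2.2.2.2.2.2.2
  set φ : ℕ → Pt → Pt := fun n x => Pi.single (d n) (τ n * v n x) with hφ
  have hφsub : ∀ n x y, ‖φ n x - φ n y‖ = |v n x - v n y| := by
    intro n x y
    rw [hφ]
    simp only
    rw [← Pi.single_sub, Pi.norm_single, ← mul_sub, norm_mul, Real.norm_eq_abs, hτ,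
      one_mul, Real.norm_eq_abs]
  have hφsum : ∀ x, Summable fun n => φ n x := by
    intro x
    refine Summable.of_norm_bounded (hasSum_div_two_pow 1 0).summable fun n => ?_
    have : ‖φ n x‖ = |v n x| := by
      simp only [hφ, Pi.norm_single, norm_mul, Real.norm_eq_abs, hτ, one_mul]
    rw [this, abs_of_nonneg (hvnonneg n x)]
    exact (hvle n x).trans (hs1 n)
  have hφ0 : ∀ n x, x ∉ V n → φ n x = 0 := fun n x hx => by simp [hφ, hv0 n x hx]
  refine ⟨fun x => conjMat.mulVec x + ∑' n, φ n x, V, W, fun x hx => ?_, fun x y => ?_, rfl, hV,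
    hanti, fun n => (H n).2.2.2.2.2.2.1, fun n => (H n).2.1, fun n => (H n).2.2.2.1,
    fun n => (H n).2.2.2.2.1, fun n => (H n).2.2.2.2.2.1, fun n x hx => ?_⟩
  · simp [fun n => hφ0 n x fun h => hx (hanti (Nat.zero_le n) h)]
  · have hterm : ∀ n, ‖φ n x - φ n y‖ ≤ ε / 2 ^ (n + 2 + 1) * e2norm (x - y) ^ α := by
      intro n
      rw [hφsub]
      refine le_rpow_of_le_of_le hα (hL n) (hsL n) (abs_nonneg _) ?_ ?_ (e2norm_nonneg _)
      · rw [abs_le]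
        constructor <;> linarith [hvnonneg n x, hvnonneg n y, hvle n x, hvle n y]
      · exact (hvlip n x y).trans (mul_le_mul_of_nonneg_left (dist_le_e2norm_sub x y) (hL n).le)
    simp only [add_sub_cancel_left]
    rw [← (hφsum x).tsum_sub (hφsum y)]
    refine (e2norm_le_two_mul_norm _).trans ?_
    have := tsum_of_norm_bounded ((hasSum_div_two_pow ε 2).mul_right (e2norm (x - y) ^ α)) hterm
    linarith
  · have hxV : x ∈ V n := (H n).2.2.2.1 hx
    have hbad := hvbad n x hx
    have hgood : ∀ m, m < n → ∃ σ c : ℝ, |σ| ≤ γ / 2 ^ (m + 2 + 1) ∧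
        ∀ᶠ y in nhds x, v m y = y (d m) + σ * y (d m + 1) + c :=
      fun m hm => hvgood m x (hanti (Nat.succ_le_of_lt hm) hxV)
    have hall : ∀ m, ∃ σ c : ℝ, m ≤ n → |σ| ≤ γ / 2 ^ (m + 2 + 1) ∧ ∀ᶠ y in nhds x,
        v m y = (if m < n then 1 else -b n) * y (d m) + σ * y (d m + 1) + c := by
      intro m
      rcases lt_trichotomy m n with hm | rfl | hm
      · obtain ⟨σ, c, h1, h2⟩ := hgood m hm
        exact ⟨σ, c, fun _ => ⟨h1, by simpa [hm] using h2⟩⟩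
      · obtain ⟨σ, c, h1, h2⟩ := hbad
        exact ⟨σ, c, fun _ => ⟨h1, by simpa using h2⟩⟩
      · exact ⟨0, 0, fun h => absurd h (by omega)⟩
    choose σ c hσ using hall
    have hsum := LocallyAffineAt.sum (s := Finset.range (n + 1)) (f := φ) (x := x) fun m hm =>
      locallyAffineAt_single (τ m) (hσ m (Nat.lt_succ_iff.1 (Finset.mem_range.1 hm))).2
    have hJ : LocallyAffineAt (fun y => conjMat.mulVec y) conjMat x :=
      ⟨0, Filter.Eventually.of_forall fun y => by simp⟩
    obtain ⟨c', hc'⟩ := hJ.add hsum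
    refine ⟨conjMat + ∑ m ∈ Finset.range (n + 1),
      (Matrix.single (d m) (d m) (τ m * if m < n then 1 else -b n) +
        Matrix.single (d m) (d m + 1) (τ m * σ m)), ⟨c', ?_⟩, ?_⟩
    · filter_upwards [hc', (H n).2.1.mem_nhds hx] with y hy hyW
      rw [← hy, tsum_eq_sum (s := Finset.range (n + 1))]
      intro m hm
      refine hφ0 m y fun hyV => ?_
      have hmn : n + 1 ≤ m := by simpa using hm
      exact Set.disjoint_left.1 (H n).2.2.2.2.1 (hanti hmn hyV) hyW
    · have hdiff : conjMat + ∑ m ∈ Finset.range (n + 1),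
          (Matrix.single (d m) (d m) (τ m * if m < n then 1 else -b n) +
            Matrix.single (d m) (d m + 1) (τ m * σ m)) -
          (conjMat + ∑ m ∈ Finset.range n, Matrix.single (d m) (d m) (τ m) -
            Matrix.single (d n) (d n) (τ n * b n)) =
          ∑ m ∈ Finset.range (n + 1), (Matrix.single (d m) (d m + 1) (τ m * σ m) : Mat2) := by
        rw [Finset.sum_add_distrib, Finset.sum_range_succ (fun m => Matrix.single (d m) (d m) _)]
        have h1 : ∑ m ∈ Finset.range n,
            (Matrix.single (d m) (d m) (τ m * if m < n then 1 else -b n) : Mat2) =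
            ∑ m ∈ Finset.range n, Matrix.single (d m) (d m) (τ m) :=
          Finset.sum_congr rfl fun m hm => by simp [Finset.mem_range.1 hm]
        have h2 : (Matrix.single (d n) (d n) (τ n * if n < n then 1 else -b n) : Mat2) =
            -Matrix.single (d n) (d n) (τ n * b n) := by
          ext i j
          simp only [Matrix.single_apply, Matrix.neg_apply, lt_irrefl, if_false]
          split_ifs <;> simp
        rw [h1, h2]
        abel
      rw [hdiff]
      refine (hsNormM_le_two_mul (e := γ / 2 ^ 2) fun k l => ?_).trans_lt (by linarith)
      rw [Matrix.sum_apply]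
      refine (Finset.abs_sum_le_sum_abs _ _).trans ?_
      refine (Finset.sum_le_sum (g := fun m => γ / 2 ^ (m + 2 + 1)) fun m hm => ?_).trans
        ((hasSum_div_two_pow γ 2).summable.sum_le_tsum _ (fun m _ => (hη m).le) |>.trans
          (hasSum_div_two_pow γ 2).tsum_eq.le)
      rw [Matrix.single_apply]
      split_ifs
      · rw [abs_mul, hτ, one_mul]
        exact (hσ m (Nat.lt_succ_iff.1 (Finset.mem_range.1 hm))).1
      · rw [abs_zero]
        exact (hη m).le

/-! ### The staircase -/

/-- The directions in which the staircase moves. -/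
def stairDir (n : ℕ) : Fin 2 := if Even n then 0 else 1

/-- The orientations of the moves of the staircase. -/
def stairSign (n : ℕ) : ℝ := if Even n then 1 else -1

/-- The lengths of the moves from the staircase to the target set. -/
def stairSlope (K : ℝ) (n : ℕ) : ℝ :=
  if Even n then ((n / 2 : ℕ) + 1 : ℝ) * (1 + 1 / K)
  else ((n / 2 : ℕ) + 1 : ℝ) + ((n / 2 : ℕ) + 2 : ℝ) / K

/-- The matrices at which the staircase touches the target set. -/
def stairTarget (K : ℝ) (n : ℕ) : Mat2 :=
  conjMat + ∑ m ∈ Finset.range n, Matrix.single (stairDir m) (stairDir m) (stairSign m) -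
    Matrix.single (stairDir n) (stairDir n) (stairSign n * stairSlope K n)

lemma not_even_two_mul_add_one (k : ℕ) : ¬Even (2 * k + 1) := by simp

lemma abs_stairSign (n : ℕ) : |stairSign n| = 1 := by
  unfold stairSign; split_ifs <;> simp

lemma stairSlope_even (K : ℝ) (k : ℕ) : stairSlope K (2 * k) = (k + 1) * (1 + 1 / K) := by
  simp [stairSlope]

lemma stairSlope_odd (K : ℝ) (k : ℕ) : stairSlope K (2 * k + 1) = (k + 1) + (k + 2) / K := by
  have h : (2 * k + 1) / 2 = k := by omega
  rw [stairSlope, if_neg (not_even_two_mul_add_one k), h]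

lemma stairSlope_pos {K : ℝ} (hK : 0 < K) (n : ℕ) : 0 < stairSlope K n := by
  unfold stairSlope; split_ifs <;> positivity

lemma stair_sum_even (k : ℕ) :
    conjMat + ∑ m ∈ Finset.range (2 * k), Matrix.single (stairDir m) (stairDir m) (stairSign m) =
      !![(k : ℝ) + 1, 0; 0, -(k + 1)] := by
  induction k with
  | zero => simp [conjMat]
  | succ k ih =>
    rw [show 2 * (k + 1) = 2 * k + 1 + 1 by ring, Finset.sum_range_succ, Finset.sum_range_succ,
      ← add_assoc, ← add_assoc, ih]
    ext i j
    fin_cases i <;> fin_cases j <;> simp [stairDir, stairSign]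
    all_goals ring

lemma stairTarget_even {K : ℝ} (k : ℕ) :
    stairTarget K (2 * k) = !![-((k : ℝ) + 1) / K, 0; 0, -(k + 1)] := by
  rw [stairTarget, stair_sum_even, stairSlope_even]
  ext i j
  fin_cases i <;> fin_cases j <;> simp [stairDir, stairSign]
  ring

lemma stairTarget_odd {K : ℝ} (k : ℕ) :
    stairTarget K (2 * k + 1) = !![(k : ℝ) + 2, 0; 0, ((k : ℝ) + 2) / K] := by
  rw [stairTarget, Finset.sum_range_succ, ← add_assoc, stair_sum_even, stairSlope_odd]
  ext i j
  fin_cases i <;> fin_cases j <;> simp [stairDir, stairSign]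
  all_goals ring

lemma stairTarget_mem {K : ℝ} (hK : 0 < K) (S1 S2 : ℝ) (n : ℕ) :
    stairTarget K n ∈ T1M K S1 ∪ T2M K S2 := by
  rcases Nat.even_or_odd' n with ⟨k, rfl | rfl⟩
  · refine Or.inr ⟨-((k : ℝ) + 1) / K, 0, ?_⟩
    rw [stairTarget_even, mul_div_cancel₀ _ hK.ne']
    simp
  · refine Or.inl ⟨(k : ℝ) + 2, 0, ?_⟩
    rw [stairTarget_odd]
    simp

lemma abs_stairTarget_le {K : ℝ} (hK : 1 < K) (n : ℕ) (i j : Fin 2) :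
    |stairTarget K n i j| ≤ (n / 2 : ℕ) + 2 := by
  have hdiv : ∀ a : ℝ, 0 ≤ a → |a / K| ≤ a := fun a ha => by
    rw [abs_of_nonneg (by positivity)]; exact div_le_self ha hK.le
  rcases Nat.even_or_odd' n with ⟨k, rfl | rfl⟩
  · rw [stairTarget_even, show 2 * k / 2 = k by omega]
    have h1 := hdiv ((k : ℝ) + 1) (by positivity)
    have h2 : |(k : ℝ) + 1| = k + 1 := abs_of_nonneg (by positivity)
    fin_cases i <;> fin_cases j <;> simp only [Fin.zero_eta, Fin.mk_one, Matrix.of_apply,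
      Matrix.cons_val', Matrix.cons_val_zero, Matrix.cons_val_one, Matrix.cons_val_fin_one,
      abs_zero, abs_neg, neg_div] <;>
      first | positivity | linarith
  · rw [stairTarget_odd, show (2 * k + 1) / 2 = k by omega]
    have h1 := hdiv ((k : ℝ) + 2) (by positivity)
    have h2 : |(k : ℝ) + 2| = k + 2 := abs_of_nonneg (by positivity)
    fin_cases i <;> fin_cases j <;> simp only [Fin.zero_eta, Fin.mk_one, Matrix.of_apply,
      Matrix.cons_val', Matrix.cons_val_zero, Matrix.cons_val_one, Matrix.cons_val_fin_one,
      abs_zero] <;>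
      first | positivity | linarith

lemma exists_le_abs_stairTarget (K : ℝ) (n : ℕ) :
    ∃ i j : Fin 2, ((n / 2 : ℕ) + 1 : ℝ) ≤ |stairTarget K n i j| := by
  rcases Nat.even_or_odd' n with ⟨k, rfl | rfl⟩
  · refine ⟨1, 1, ?_⟩
    have h : |-(k + 1 : ℝ)| = k + 1 := by rw [abs_neg, abs_of_nonneg (by positivity)]
    rw [stairTarget_even, show 2 * k / 2 = k by omega]
    exact h.ge
  · refine ⟨0, 0, ?_⟩
    have h : |(k + 2 : ℝ)| = k + 2 := abs_of_nonneg (by positivity)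
    rw [stairTarget_odd, show (2 * k + 1) / 2 = k by omega]
    change (k : ℝ) + 1 ≤ |(k + 2 : ℝ)|
    linarith

lemma abs_apply_le_hsNormM (A : Mat2) (i j : Fin 2) : |A i j| ≤ hsNormM A := by
  refine Real.abs_le_sqrt ?_
  fin_cases i <;> fin_cases j <;> simp <;>
    nlinarith [sq_nonneg (A 0 0), sq_nonneg (A 0 1), sq_nonneg (A 1 0), sq_nonneg (A 1 1)]

lemma hsNormM_bounds_of_near_stairTarget {K : ℝ} (hK : 1 < K) {n : ℕ} {M : Mat2}
    (h : hsNormM (M - stairTarget K n) < 1) :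
    ((n / 2 : ℕ) : ℝ) < hsNormM M ∧ hsNormM M ≤ 2 * (n / 2 : ℕ) + 6 := by
  have hdiff : ∀ i j, |M i j - stairTarget K n i j| < 1 := fun i j =>
    (abs_apply_le_hsNormM (M - stairTarget K n) i j).trans_lt h
  constructor
  · obtain ⟨i, j, hij⟩ := exists_le_abs_stairTarget K n
    have h1 := abs_apply_le_hsNormM M i j
    have h2 := abs_sub_abs_le_abs_sub (stairTarget K n i j) (M i j)
    have h3 := hdiff i j
    rw [abs_sub_comm] at h3
    linarith
  · refine (hsNormM_le_two_mul (e := (n / 2 : ℕ) + 3) fun i j => ?_).trans (le_of_eq (by ring))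
    have h2 := abs_sub_abs_le_abs_sub (M i j) (stairTarget K n i j)
    linarith [hdiff i j, abs_stairTarget_le hK n i j]

/-- The proportion of the mass that survives the first `2 * k` steps of the staircase. -/
def stairMass (K : ℝ) (k : ℕ) : ℝ :=
  ∏ n ∈ Finset.range (2 * k), stairSlope K n / (1 + stairSlope K n)

lemma stairMass_succ {K : ℝ} (hK : 0 < K) (k : ℕ) :
    stairMass K (k + 1) = stairMass K k *
      (((k : ℝ) + 1) / (k + 2) * (1 - (K - 1) / (K + 1) / (k + 1 + K / (K + 1)))) := by
  rw [stairMass, show 2 * (k + 1) = 2 * k + 1 + 1 by ring, Finset.prod_range_succ,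
    Finset.prod_range_succ, stairSlope_even, stairSlope_odd, mul_assoc, ← stairMass]
  congr 1
  have h1 : (k : ℝ) + 1 + K / (K + 1) ≠ 0 := by positivity
  have h2 : (1 : ℝ) + (k + 1) * (1 + 1 / K) ≠ 0 := by positivity
  have h3 : (1 : ℝ) + ((k + 1) + (k + 2) / K) ≠ 0 := by positivity
  field_simp
  ring

lemma stairMass_bounds {K : ℝ} (hK : 1 < K) (k : ℕ) :
    1 / ((k : ℝ) + 1) * (K / (K + 1) / (k + K / (K + 1))) ^ ((K - 1) / (K + 1)) ≤ stairMass K k ∧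
    stairMass K k ≤
      1 / ((k : ℝ) + 1) * ((2 - K / (K + 1)) / (k + (2 - K / (K + 1)))) ^ ((K - 1) / (K + 1)) := by
  set q := (K - 1) / (K + 1) with hq
  set θ := K / (K + 1) with hθ
  have hq0 : 0 < q := div_pos (by linarith) (by linarith)
  have hq1 : q < 1 := by rw [hq, div_lt_one (by linarith)]; linarith
  have hθ0 : 0 < θ := by positivity
  have hθ1 : θ < 1 := by rw [hθ, div_lt_one (by linarith)]; linarith
  have hqθ : q = 2 * θ - 1 := by rw [hq, hθ]; field_simp; ring
  induction k with
  | zero =>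
    have : 2 - θ ≠ 0 := by linarith
    simp [stairMass, hθ0.ne', this]
  | succ k ih =>
    rw [stairMass_succ (by linarith)]
    have hk : (0 : ℝ) ≤ k := k.cast_nonneg
    have hx : 0 < (k : ℝ) + 1 + θ := by linarith
    have hlow : (((k : ℝ) + θ) / (k + 1 + θ)) ^ q ≤ 1 - q / (k + 1 + θ) := by
      have h := rpow_one_add_le_one_add_mul_self (s := -1 / ((k : ℝ) + 1 + θ)) (p := q)
        (by rw [le_div_iff₀ hx]; linarith) hq0.le hq1.le
      convert h using 1
      · congr 1; field_simp; ring
      · ring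
    have hupp : 1 - q / (k + 1 + θ) ≤ (((k : ℝ) + (2 - θ)) / (k + 1 + (2 - θ))) ^ q := by
      have hy : 0 < (k : ℝ) + (2 - θ) := by linarith
      have h := rpow_one_add_le_one_add_mul_self (s := 1 / ((k : ℝ) + (2 - θ))) (p := q)
        (by linarith [one_div_pos.2 hy]) hq0.le hq1.le
      have h1 : (1 : ℝ) + 1 / (k + (2 - θ)) = (((k : ℝ) + (2 - θ)) / (k + 1 + (2 - θ)))⁻¹ := by
        rw [inv_div]; field_simp; ring
      have h2 : 1 + q * (1 / ((k : ℝ) + (2 - θ))) = (1 - q / (k + 1 + θ))⁻¹ := by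
        have h3 : (1 : ℝ) - q / (k + 1 + θ) = (k + (2 - θ)) / (k + 1 + θ) := by
          rw [hqθ]; field_simp; ring
        rw [h3, inv_div, hqθ]; field_simp; ring
      have h4 : 0 < 1 - q / (k + 1 + θ) := by
        rw [sub_pos, div_lt_one hx]; linarith
      have h5 : 0 < ((k : ℝ) + (2 - θ)) / (k + 1 + (2 - θ)) := div_pos hy (by linarith)
      rw [h1, h2, Real.inv_rpow h5.le] at h
      exact (inv_le_inv₀ (Real.rpow_pos_of_pos h5 q) h4).1 h
    have hpos : (0 : ℝ) ≤ (k + 1) / (k + 2) := by positivity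
    have htele : ∀ a : ℝ, 0 < a → 1 / (((k + 1 : ℕ) : ℝ) + 1) * (a / (((k + 1 : ℕ) : ℝ) + a)) ^ q =
        1 / ((k : ℝ) + 1) * (a / (k + a)) ^ q *
          ((k + 1) / (k + 2) * ((k + a) / (k + 1 + a)) ^ q) := by
      intro a ha
      have h1 : a / (((k + 1 : ℕ) : ℝ) + a) = a / (k + a) * ((k + a) / (k + 1 + a)) := by
        push_cast
        field_simp
      rw [h1, Real.mul_rpow (by positivity) (by positivity)]
      push_cast
      field_simp
      ring
    have hlowpos : 0 ≤ (((k : ℝ) + θ) / (k + 1 + θ)) ^ q := by positivity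
    constructor
    · rw [htele θ hθ0]
      refine mul_le_mul ih.1 (mul_le_mul_of_nonneg_left hlow hpos) (by positivity) ?_
      exact le_trans (by positivity) ih.1
    · rw [htele (2 - θ) (by linarith)]
      refine mul_le_mul ih.2 (mul_le_mul_of_nonneg_left hupp hpos)
        (mul_nonneg hpos (hlowpos.trans hlow)) ?_
      have : 0 < (2 - θ) / (k + (2 - θ)) := div_pos (by linarith) (by linarith)
      positivity

lemma stairMass_rpow_bounds {K : ℝ} (hK : 1 < K) (k : ℕ) :
    1 / 2 * ((k : ℝ) + 1) ^ (-(2 * K / (K + 1))) ≤ stairMass K k ∧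
    stairMass K k ≤ 2 * ((k : ℝ) + 1) ^ (-(2 * K / (K + 1))) := by
  have h := stairMass_bounds hK k
  have hq0 : 0 < (K - 1) / (K + 1) := div_pos (by linarith) (by linarith)
  have hq1 : (K - 1) / (K + 1) ≤ 1 := by rw [div_le_one (by linarith)]; linarith
  have hθ1 : K / (K + 1) < 1 := by rw [div_lt_one (by linarith)]; linarith
  have hθ0 : 1 / 2 < K / (K + 1) := by rw [div_lt_div_iff₀ (by norm_num) (by linarith)]; linarith
  have hp : 2 * K / (K + 1) = 1 + (K - 1) / (K + 1) := by field_simp; ring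
  have hk : (0 : ℝ) < (k : ℝ) + 1 := by positivity
  have hk0 : (0 : ℝ) ≤ k := k.cast_nonneg
  rw [hp, Real.rpow_neg hk.le, Real.rpow_add hk, Real.rpow_one, mul_inv, ← Real.inv_rpow hk.le]
  set q := (K - 1) / (K + 1)
  set θ := K / (K + 1)
  have hkey : ∀ a : ℝ, 0 ≤ a →
      (a / ((k : ℝ) + 1)) ^ q = a ^ q * ((k : ℝ) + 1)⁻¹ ^ q := fun a ha => by
    rw [div_eq_mul_inv, Real.mul_rpow ha (by positivity)]
  constructor
  · refine le_trans ?_ h.1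
    rw [one_div ((k : ℝ) + 1), mul_left_comm]
    refine mul_le_mul_of_nonneg_left ?_ (by positivity)
    calc 1 / 2 * ((k : ℝ) + 1)⁻¹ ^ q ≤ (1 / 2) ^ q * ((k : ℝ) + 1)⁻¹ ^ q := by
          refine mul_le_mul_of_nonneg_right ?_ (by positivity)
          exact Real.self_le_rpow_of_le_one (by norm_num) (by norm_num) hq1
      _ = (1 / 2 / ((k : ℝ) + 1)) ^ q := (hkey _ (by norm_num)).symm
      _ ≤ (θ / (k + θ)) ^ q := by
          refine Real.rpow_le_rpow (by positivity) ?_ hq0.le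
          exact div_le_div₀ (by linarith) hθ0.le (by linarith) (by linarith)
  · refine h.2.trans ?_
    rw [one_div ((k : ℝ) + 1), mul_left_comm 2]
    refine mul_le_mul_of_nonneg_left ?_ (by positivity)
    calc ((2 - θ) / (k + (2 - θ))) ^ q ≤ (2 / ((k : ℝ) + 1)) ^ q := by
          refine Real.rpow_le_rpow (div_nonneg (by linarith) (by linarith)) ?_ hq0.le
          exact div_le_div₀ (by norm_num) (by linarith) hk (by linarith)
      _ = 2 ^ q * ((k : ℝ) + 1)⁻¹ ^ q := hkey _ (by norm_num)
      _ ≤ 2 * ((k : ℝ) + 1)⁻¹ ^ q := by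
          refine mul_le_mul_of_nonneg_right ?_ (by positivity)
          exact Real.rpow_le_self_of_one_le (by norm_num) hq1

/-! ### The distribution function of the gradient -/

lemma volume_eq_prod_mul {V : ℕ → Set Pt} {r : ℕ → ℝ} (hr : ∀ n, 0 ≤ r n)
    (h : ∀ n, volume (V (n + 1)) = ENNReal.ofReal (r n) * volume (V n)) (n : ℕ) :
    volume (V n) = ENNReal.ofReal (∏ m ∈ Finset.range n, r m) * volume (V 0) := by
  induction n with
  | zero => simp
  | succ n ih =>
    rw [h, ih, Finset.prod_range_succ, mul_comm (∏ m ∈ Finset.range n, r m),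
      ENNReal.ofReal_mul (hr n), mul_assoc]

lemma tendsto_stairMass {K : ℝ} (hK : 1 < K) :
    Filter.Tendsto (stairMass K) Filter.atTop (nhds 0) := by
  have hp : 0 < 2 * K / (K + 1) := by positivity
  refine squeeze_zero (fun k => le_trans (by positivity) (stairMass_rpow_bounds hK k).1)
    (fun k => (stairMass_rpow_bounds hK k).2) ?_
  have h := ((tendsto_rpow_neg_atTop hp).comp
    (Filter.tendsto_atTop_add_const_right _ 1 tendsto_natCast_atTop_atTop)).const_mul 2
  rw [mul_zero] at h
  exact h

/-- In a nested sequence of sets whose measures tend to zero, almost every point is eventually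
dropped. -/
lemma volume_diff_iUnion_eq_zero {V W : ℕ → Set Pt}
    (hnull : ∀ n, volume (V n \ (V (n + 1) ∪ W n)) = 0) {φ : ℕ → ℕ}
    (hlim : Filter.Tendsto (fun n => volume (V (φ n))) Filter.atTop (nhds 0)) :
    volume (V 0 \ ⋃ n, W n) = 0 := by
  have hsub : V 0 \ ⋃ n, W n ⊆ (⋂ n, V n) ∪ ⋃ n, (V n \ (V (n + 1) ∪ W n)) := by
    rintro x ⟨hx0, hxW⟩
    by_contra hcon
    simp only [Set.mem_union, Set.mem_iInter, Set.mem_iUnion, Set.mem_sdiff, not_or, not_exists,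
      not_and, not_not] at hcon hxW
    refine hcon.1 fun n => ?_
    induction n with
    | zero => exact hx0
    | succ n ih =>
      by_contra hn
      exact hxW n (hcon.2 n ih hn)
  refine measure_mono_null hsub (measure_union_null ?_ (measure_iUnion_null hnull))
  refine le_antisymm (ge_of_tendsto hlim (Filter.Eventually.of_forall fun n => ?_)) bot_le
  exact measure_mono (Set.iInter_subset V (φ n))

lemma le_volume_superlevel {p : ℝ} (hp0 : 0 ≤ p) (hp2 : p ≤ 2) {Ω : Set Pt} {V W : ℕ → Set Pt}
    {m : ℕ → ℝ} (hm : ∀ k : ℕ, 1 / 2 * ((k : ℝ) + 1) ^ (-p) ≤ m k)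
    (hvol : ∀ k, volume (V (2 * k)) = ENNReal.ofReal (m k) * volume Ω)
    (hVΩ : ∀ n, V n ⊆ Ω) (hanti : Antitone V) (hdisj : ∀ n, Disjoint (V (n + 1)) (W n))
    (hcover : volume (Ω \ ⋃ n, W n) = 0) {g : Pt → ℝ}
    (hg : ∀ n, ∀ x ∈ W n, ((n / 2 : ℕ) : ℝ) < g x) {t : ℝ} (ht : 2 ≤ t) :
    ENNReal.ofReal (t ^ (-p) / 8) * volume Ω ≤ volume {x | x ∈ Ω ∧ t < g x} := by
  set j := ⌈t⌉₊
  have hj : t ≤ j := Nat.le_ceil t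
  have hj' : (j : ℝ) < t + 1 := Nat.ceil_lt_add_one (by linarith)
  have hsub : V (2 * j) ⊆ {x | x ∈ Ω ∧ t < g x} ∪ (Ω \ ⋃ n, W n) := by
    intro x hx
    by_cases hxW : x ∈ ⋃ n, W n
    · obtain ⟨n, hn⟩ := Set.mem_iUnion.1 hxW
      have hle : 2 * j ≤ n := by
        by_contra! hlt
        exact Set.disjoint_left.1 (hdisj n) (hanti hlt hx) hn
      have hjn : (j : ℝ) ≤ ((n / 2 : ℕ) : ℝ) := by exact_mod_cast (by omega : j ≤ n / 2)
      exact Or.inl ⟨hVΩ _ hx, hj.trans_lt (hjn.trans_lt (hg n x hn))⟩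
    · exact Or.inr ⟨hVΩ _ hx, hxW⟩
  have h1 : t ^ (-p) / 8 ≤ m j := by
    refine le_trans ?_ (hm j)
    have h2 : (2 * t) ^ (-p) ≤ ((j : ℝ) + 1) ^ (-p) :=
      Real.rpow_le_rpow_of_nonpos (by positivity) (by linarith) (by linarith)
    have h3 : (2 : ℝ) ^ (-(2 : ℝ)) ≤ 2 ^ (-p) :=
      Real.rpow_le_rpow_of_exponent_le (by norm_num) (by linarith)
    rw [Real.mul_rpow (by norm_num) (by linarith)] at h2
    have h4 : (2 : ℝ) ^ (-(2 : ℝ)) = 1 / 4 := by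
      rw [Real.rpow_neg (by norm_num), Real.rpow_two]; norm_num
    have h5 := mul_le_mul_of_nonneg_right (h4 ▸ h3)
      (Real.rpow_nonneg (by linarith) (-p) : 0 ≤ t ^ (-p))
    linarith
  calc ENNReal.ofReal (t ^ (-p) / 8) * volume Ω ≤ volume (V (2 * j)) := by
        rw [hvol]; gcongr
    _ ≤ volume {x | x ∈ Ω ∧ t < g x} + volume (Ω \ ⋃ n, W n) :=
        (measure_mono hsub).trans (measure_union_le _ _)
    _ = volume {x | x ∈ Ω ∧ t < g x} := by rw [hcover, add_zero]

lemma volume_superlevel_le {p : ℝ} (hp0 : 0 ≤ p) (hp2 : p ≤ 2) {Ω : Set Pt} {V W : ℕ → Set Pt}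
    {m : ℕ → ℝ} (hm : ∀ k : ℕ, m k ≤ 2 * ((k : ℝ) + 1) ^ (-p))
    (hvol : ∀ k, volume (V (2 * k)) = ENNReal.ofReal (m k) * volume Ω)
    (hanti : Antitone V) (hWV : ∀ n, W n ⊆ V n)
    (hcover : volume (Ω \ ⋃ n, W n) = 0) {g : Pt → ℝ}
    (hg : ∀ n, ∀ x ∈ W n, g x ≤ 2 * (n / 2 : ℕ) + 6) {t : ℝ} (ht : 8 ≤ t) :
    volume {x | x ∈ Ω ∧ t < g x} ≤ ENNReal.ofReal (32 * t ^ (-p)) * volume Ω := by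
  set j := ⌊t / 4⌋₊
  have hj : (j : ℝ) ≤ t / 4 := Nat.floor_le (by linarith)
  have hj' : t / 4 < j + 1 := Nat.lt_floor_add_one _
  have hsub : {x | x ∈ Ω ∧ t < g x} ⊆ V (2 * j) ∪ (Ω \ ⋃ n, W n) := by
    rintro x ⟨hxΩ, hx⟩
    by_cases hxW : x ∈ ⋃ n, W n
    · obtain ⟨n, hn⟩ := Set.mem_iUnion.1 hxW
      have h1 := hx.trans_le (hg n x hn)
      have h2 : 4 * j < 2 * (n / 2) + 6 := by
        have : (4 * j : ℝ) < 2 * (n / 2 : ℕ) + 6 := by linarith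
        exact_mod_cast this
      have h3 : 2 ≤ j := Nat.le_floor (by push_cast; linarith)
      exact Or.inl (hanti (by omega : 2 * j ≤ n) (hWV n hn))
    · exact Or.inr ⟨hxΩ, hxW⟩
  have h1 : m j ≤ 32 * t ^ (-p) := by
    refine (hm j).trans ?_
    have h2 : ((j : ℝ) + 1) ^ (-p) ≤ (t / 4) ^ (-p) :=
      Real.rpow_le_rpow_of_nonpos (by positivity) (by linarith) (by linarith)
    have h3 : (4 : ℝ) ^ p ≤ 4 ^ (2 : ℝ) :=
      Real.rpow_le_rpow_of_exponent_le (by norm_num) (by linarith)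
    rw [Real.div_rpow (by linarith) (by norm_num), Real.rpow_neg (by norm_num : (0 : ℝ) ≤ 4),
      div_inv_eq_mul] at h2
    rw [Real.rpow_two] at h3
    have h5 : 0 ≤ t ^ (-p) := Real.rpow_nonneg (by linarith) _
    nlinarith
  calc volume {x | x ∈ Ω ∧ t < g x} ≤ volume (V (2 * j)) + volume (Ω \ ⋃ n, W n) :=
        (measure_mono hsub).trans (measure_union_le _ _)
    _ ≤ ENNReal.ofReal (32 * t ^ (-p)) * volume Ω := by
        rw [hcover, add_zero, hvol]; gcongr

/-! ### Integrability and the distribution function -/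

lemma integrable_of_meas_superlevel_le {X : Type*} [MeasurableSpace X] {μ : Measure X}
    [IsFiniteMeasure μ] {g : X → ℝ} (hg : Measurable g) (hg0 : ∀ x, 0 ≤ g x) {p a c : ℝ}
    (hp : 1 < p) (hc : 0 < c)
    (h : ∀ t, c < t → μ {x | t < g x} ≤ ENNReal.ofReal (a * t ^ (-p))) :
    Integrable g μ := by
  refine ⟨hg.aestronglyMeasurable, ?_⟩
  rw [hasFiniteIntegral_iff_ofReal (Filter.Eventually.of_forall hg0),
    lintegral_eq_lintegral_meas_lt μ (Filter.Eventually.of_forall hg0) hg.aemeasurable,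
    ← Set.Ioc_union_Ioi_eq_Ioi hc.le]
  refine (lintegral_union_le _ _ _).trans_lt (ENNReal.add_lt_top.2 ⟨?_, ?_⟩)
  · refine (lintegral_mono fun t => measure_mono (Set.subset_univ _)).trans_lt ?_
    rw [setLIntegral_const]
    exact ENNReal.mul_lt_top (measure_lt_top _ _) measure_Ioc_lt_top
  · refine (setLIntegral_mono' measurableSet_Ioi fun t ht => h t ht).trans_lt ?_
    have hint : IntegrableOn (fun t : ℝ => a * t ^ (-p)) (Set.Ioi c) :=
      (integrableOn_Ioi_rpow_of_lt (by linarith) hc).const_mul a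
    exact hint.lintegral_lt_top

lemma lintegral_rpow_eq_top_of_le_meas_superlevel {X : Type*} [MeasurableSpace X] {μ : Measure X}
    {g : X → ℝ} (hg : Measurable g) (hg0 : ∀ x, 0 ≤ g x) {p a c : ℝ} (hp : 0 < p) (ha : 0 < a)
    (hc : 0 < c) (h : ∀ t, c < t → ENNReal.ofReal (a * t ^ (-p)) ≤ μ {x | t < g x}) :
    ∫⁻ x, ENNReal.ofReal (g x ^ p) ∂μ = ⊤ := by
  rw [lintegral_rpow_eq_lintegral_meas_lt_mul μ (Filter.Eventually.of_forall hg0) hg.aemeasurable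
    hp]
  have htop : ∫⁻ t in Set.Ioi c, ENNReal.ofReal (a * t⁻¹) = ⊤ := by
    by_contra hne
    refine not_integrableOn_Ioi_inv (a := c) ?_
    have h1 : IntegrableOn (fun t : ℝ => a * t⁻¹) (Set.Ioi c) := by
      refine ⟨by fun_prop, ?_⟩
      rw [hasFiniteIntegral_iff_ofReal]
      · exact lt_top_iff_ne_top.2 hne
      · filter_upwards [self_mem_ae_restrict measurableSet_Ioi] with t ht
        exact mul_nonneg ha.le (inv_nonneg.2 (hc.trans ht).le)
    have h2 := h1.const_mul a⁻¹
    simpa [IntegrableOn, inv_mul_cancel_left₀ ha.ne'] using h2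
  refine ENNReal.mul_eq_top.2 (Or.inl ⟨by simpa using hp, top_le_iff.1 ?_⟩)
  rw [← htop]
  refine le_trans ?_ (lintegral_mono_set (Set.Ioi_subset_Ioi hc.le))
  refine setLIntegral_mono' measurableSet_Ioi fun t ht => ?_
  have ht0 : 0 < t := hc.trans ht
  calc ENNReal.ofReal (a * t⁻¹) = ENNReal.ofReal (a * t ^ (-p)) * ENNReal.ofReal (t ^ (p - 1)) := by
        rw [← ENNReal.ofReal_mul (by positivity), mul_assoc, ← Real.rpow_add ht0,
          show -p + (p - 1) = -1 by ring, Real.rpow_neg_one]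
    _ ≤ _ := by gcongr; exact h t ht

/-! ### The theorem -/

lemma setDistM_lt_of_mem {A Q : Mat2} {T : Set Mat2} {r : ℝ} (hQ : Q ∈ T)
    (h : hsNormM (A - Q) < r) : setDistM A T < r := by
  have hbdd : BddBelow {r | ∃ Q ∈ T, r = hsNormM (A - Q)} := by
    refine ⟨0, ?_⟩
    rintro _ ⟨_, _, rfl⟩
    exact hsNormM_nonneg _
  exact (csInf_le hbdd ⟨Q, hQ, rfl⟩).trans_lt h

lemma continuous_of_e2norm_sub_le_rpow {g : Pt → Pt} {C α : ℝ} (hα : 0 < α)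
    (h : ∀ x y, e2norm (g x - g y) ≤ C * e2norm (x - y) ^ α) : Continuous g := by
  rw [continuous_iff_continuousAt]
  intro x
  rw [ContinuousAt, tendsto_iff_dist_tendsto_zero]
  refine squeeze_zero (fun _ => dist_nonneg)
    (fun y => (dist_le_e2norm_sub _ _).trans (h y x)) ?_
  have hcont : Continuous fun y : Pt => C * e2norm (y - x) ^ α := by
    unfold e2norm
    exact continuous_const.mul ((by fun_prop : Continuous fun y : Pt =>
      √((y - x) 0 ^ 2 + (y - x) 1 ^ 2)).rpow_const fun _ => Or.inr hα.le)
  have h0 : C * e2norm (x - x) ^ α = 0 := by simp [e2norm, Real.zero_rpow hα.ne']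
  simpa only [h0] using hcont.tendsto x

/-- A perturbation of the conjugation which is affine near almost every point, with gradients
near the targets of the staircase, and whose gradient has the distribution prescribed by the
staircase. -/
lemma exists_staircase_map {K : ℝ} (hK : 1 < K) {Ω : Set Pt} (hΩ : IsOpen Ω)
    (hfin : volume Ω ≠ ⊤) {α ε γ : ℝ} (hα : α ∈ Set.Ioo (0 : ℝ) 1) (hε : 0 < ε) (hγ : 0 < γ) :
    ∃ (f : Pt → Pt) (G : Set Pt),
      (∀ x, x ∉ Ω → f x = ![x 0, -x 1]) ∧
      (∀ x y, e2norm ((f x - ![x 0, -x 1]) - (f y - ![y 0, -y 1])) ≤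
        ε / 2 * e2norm (x - y) ^ α) ∧
      IsOpen G ∧ G ⊆ Ω ∧ volume (Ω \ G) = 0 ∧
      (∀ x ∈ G, ∃ n, LocallyAffineAt f (jacobian f x) x ∧
        hsNormM (jacobian f x - stairTarget K n) < γ) ∧
      (∀ t, 2 ≤ t → ENNReal.ofReal (t ^ (-(2 * K / (K + 1))) / 8) * volume Ω ≤
        volume {x | x ∈ Ω ∧ t < hsNormM (jacobian f x)}) ∧
      ∀ t, 8 ≤ t → volume {x | x ∈ Ω ∧ t < hsNormM (jacobian f x)} ≤
        ENNReal.ofReal (32 * t ^ (-(2 * K / (K + 1)))) * volume Ω := by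
  have hK0 : 0 < K := by linarith
  have hp0 : 0 ≤ 2 * K / (K + 1) := by positivity
  have hp2 : 2 * K / (K + 1) ≤ 2 := by rw [div_le_iff₀ (by linarith)]; linarith
  obtain ⟨f, V, W, hf, hholder, hV0, hVo, hanti, hvol, hWo, hWV, hdisj, hnull, haff⟩ :=
    exists_superposition stairDir abs_stairSign (stairSlope_pos hK0) hΩ hα hε
      (lt_min hγ one_pos)
  have hJ : ∀ x : Pt, ![x 0, -x 1] = conjMat.mulVec x := fun x => (conjMat_mulVec x).symm
  have hVΩ : ∀ n, V n ⊆ Ω := fun n => hV0 ▸ hanti (Nat.zero_le n)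
  have hmass : ∀ k, volume (V (2 * k)) = ENNReal.ofReal (stairMass K k) * volume Ω := fun k => by
    rw [volume_eq_prod_mul (fun n => ?_) hvol, hV0, stairMass]
    have := stairSlope_pos hK0 n
    positivity
  have hjac : ∀ n, ∀ x ∈ W n, LocallyAffineAt f (jacobian f x) x ∧
      hsNormM (jacobian f x - stairTarget K n) < min γ 1 := fun n x hx => by
    obtain ⟨M, hM, hMn⟩ := haff n x hx
    rw [hM.jacobian_eq]
    exact ⟨hM, hMn⟩
  have hbounds := fun n x hx =>
    hsNormM_bounds_of_near_stairTarget hK ((hjac n x hx).2.trans_le (min_le_right _ _))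
  have hcover : volume (Ω \ ⋃ n, W n) = 0 := by
    rw [← hV0]
    refine volume_diff_iUnion_eq_zero hnull (φ := fun k => 2 * k) ?_
    have h := ENNReal.Tendsto.mul_const (b := volume Ω)
      (ENNReal.tendsto_ofReal (tendsto_stairMass hK)) (Or.inr hfin)
    rw [ENNReal.ofReal_zero, zero_mul] at h
    exact h.congr fun k => (hmass k).symm
  refine ⟨f, ⋃ n, W n, fun x hx => (hf x hx).trans (hJ x).symm, fun x y => ?_, isOpen_iUnion hWo,
    Set.iUnion_subset fun n => (hWV n).trans (hVΩ n), hcover, fun x hx => ?_, fun t ht => ?_,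
    fun t ht => ?_⟩
  · simpa only [hJ] using hholder x y
  · obtain ⟨n, hn⟩ := Set.mem_iUnion.1 hx
    exact ⟨n, (hjac n x hn).1, (hjac n x hn).2.trans_le (min_le_left _ _)⟩
  · exact le_volume_superlevel hp0 hp2 (fun k => (stairMass_rpow_bounds hK k).1) hmass hVΩ hanti
      hdisj hcover (fun n x hx => (hbounds n x hx).1) ht
  · exact volume_superlevel_le hp0 hp2 (fun k => (stairMass_rpow_bounds hK k).2) hmass hanti hWV
      hcover (fun n x hx => (hbounds n x hx).2) ht

/-- Proposition 5.9 of the paper.  Here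
`S = (S₁+S₂+2S₁S₂)/(2+S₁+S₂) ∈ (1, K]` and `Jx = (x₁, −x₂)`.  The constant
`c` and the exponent `p` depend only on `K, S₁, S₂, δ₀`. -/
theorem statement14 (K S1 S2 : ℝ) (hK : 1 < K)
    (hS1 : S1 ∈ Set.Icc (1 / K) K) (hS2 : S2 ∈ Set.Icc (1 / K) K)
    (hprod : 1 < S1 * S2)
    (δ₀ : ℝ) (hδ₀ : 0 < δ₀)
    (hδ₀' : δ₀ < 2 * K / (K + 1) -
      2 * ((S1 + S2 + 2 * S1 * S2) / (2 + S1 + S2)) /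
        ((S1 + S2 + 2 * S1 * S2) / (2 + S1 + S2) + 1)) :
    ∃ c : ℝ, 1 < c ∧
    ∃ p ∈ Set.Ioc (2 * K / (K + 1) - δ₀) (2 * K / (K + 1)),
    ∀ Ω : Set Pt, IsOpen Ω → Bornology.IsBounded Ω → Ω.Nonempty →
    ∀ α ε γ : ℝ, α ∈ Set.Ioo (0 : ℝ) 1 → 0 < ε → 0 < γ →
      ∃ (f : Pt → Pt) (Df : Pt → Mat2),
        ContinuousOn f (closure Ω) ∧
        PiecewiseAffineOn f Df Ω ∧
        -- (i) boundary condition `f = Jx` on `∂Ω`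
        (∀ x ∈ frontier Ω, f x = ![x 0, -x 1]) ∧
        -- (ii) the `C^α` Hölder seminorm of `f − Jx` is `< ε`
        (∃ C : ℝ, 0 ≤ C ∧ C < ε ∧ ∀ x ∈ closure Ω, ∀ y ∈ closure Ω,
          e2norm ((f x - ![x 0, -x 1]) - (f y - ![y 0, -y 1])) ≤
            C * e2norm (x - y) ^ α) ∧
        -- (iii) approximate differential inclusion
        (∀ᵐ x ∂volume, x ∈ Ω → setDistM (Df x) (T1M K S1 ∪ T2M K S2) < γ) ∧
        -- (iv) two-sided bound on the distribution function of `∇f`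
        (∀ t : ℝ, c < t →
          c⁻¹ * t ^ (-(2 * K / (K + 1))) * (volume Ω).toReal <
            (volume {x | x ∈ Ω ∧ t < hsNormM (Df x)}).toReal ∧
          (volume {x | x ∈ Ω ∧ t < hsNormM (Df x)}).toReal <
            c * t ^ (-p) * (volume Ω).toReal) ∧
        -- `∇f ∈ L^p_weak`
        (∃ Cw : ℝ, ∀ t : ℝ, 0 < t →
          t ^ p * (volume {x | x ∈ Ω ∧ t < hsNormM (Df x)}).toReal ≤ Cw) ∧
        -- `∇f ∈ L¹(Ω)`, i.e. `f ∈ W^{1,1}`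
        IntegrableOn (fun x => hsNormM (Df x)) Ω ∧
        -- `∇f ∉ L^{2K/(K+1)}(Ω)`
        ∫⁻ x in Ω, ENNReal.ofReal (hsNormM (Df x) ^ (2 * K / (K + 1))) = ⊤ := by
  have hK0 : 0 < K := by linarith
  have hp : 1 < 2 * K / (K + 1) := by rw [lt_div_iff₀ (by linarith)]; linarith
  refine ⟨100, by norm_num, 2 * K / (K + 1), ⟨by linarith, le_rfl⟩,
    fun Ω hΩ hbdd hne α ε γ hα hε hγ => ?_⟩
  have hfin : volume Ω ≠ ⊤ := hbdd.measure_lt_top.ne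
  have hpos : 0 < (volume Ω).toReal :=
    ENNReal.toReal_pos (hΩ.measure_pos volume hne).ne' hfin
  have : IsFiniteMeasure (volume.restrict Ω) := ⟨by simpa using hfin.lt_top⟩
  obtain ⟨f, G, hf, hholder, hGo, hGΩ, hGnull, hjac, hlow, hupp⟩ :=
    exists_staircase_map hK hΩ hfin hα hε hγ
  set p := 2 * K / (K + 1)
  have hmeas := measurable_hsNormM_jacobian f
  have hset : ∀ t, volume.restrict Ω {x | t < hsNormM (jacobian f x)} =
      volume {x | x ∈ Ω ∧ t < hsNormM (jacobian f x)} := fun t => by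
    rw [Measure.restrict_apply (measurableSet_lt measurable_const hmeas), Set.inter_comm]
    rfl
  have hle : ∀ t, volume {x | x ∈ Ω ∧ t < hsNormM (jacobian f x)} ≤ volume Ω :=
    fun t => measure_mono fun x hx => hx.1
  have hlow' : ∀ t, 2 ≤ t → t ^ (-p) / 8 * (volume Ω).toReal ≤
      (volume {x | x ∈ Ω ∧ t < hsNormM (jacobian f x)}).toReal := fun t ht => by
    have h := ENNReal.toReal_mono (ne_top_of_le_ne_top hfin (hle t)) (hlow t ht)
    rwa [ENNReal.toReal_mul, ENNReal.toReal_ofReal (by positivity)] at h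
  have hupp' : ∀ t, 8 ≤ t → (volume {x | x ∈ Ω ∧ t < hsNormM (jacobian f x)}).toReal ≤
      32 * t ^ (-p) * (volume Ω).toReal := fun t ht => by
    have h := ENNReal.toReal_mono (ENNReal.mul_ne_top ENNReal.ofReal_ne_top hfin) (hupp t ht)
    rwa [ENNReal.toReal_mul, ENNReal.toReal_ofReal (by positivity)] at h
  have hcont : Continuous f := by
    have h := (continuous_of_e2norm_sub_le_rpow (g := fun x => f x - ![x 0, -x 1]) hα.1
      hholder).add (by fun_prop : Continuous fun x : Pt => conjMat.mulVec x)
    refine h.congr fun x => ?_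
    rw [Pi.add_apply, conjMat_mulVec, sub_add_cancel]
  refine ⟨f, jacobian f, hcont.continuousOn,
    piecewiseAffineOn_of_locallyAffineAt hGo hGΩ hGnull fun x hx =>
      (hjac x hx).imp' (fun _ => jacobian f x) fun _ h => h.1,
    fun x hx => hf x fun hxΩ => (hΩ.frontier_eq ▸ hx).2 hxΩ,
    ⟨ε / 2, by positivity, by linarith, fun x _ y _ => hholder x y⟩, ?_, fun t ht => ⟨?_, ?_⟩,
    ⟨8 ^ p * (volume Ω).toReal + 32 * (volume Ω).toReal, fun t ht => ?_⟩, ?_, ?_⟩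
  · filter_upwards [measure_eq_zero_iff_ae_notMem.1 hGnull] with x hx hxΩ
    obtain ⟨n, -, hn⟩ := hjac x (by_contra fun hxG => hx ⟨hxΩ, hxG⟩)
    exact setDistM_lt_of_mem (stairTarget_mem hK0 S1 S2 n) hn
  · refine lt_of_lt_of_le ?_ (hlow' t (by linarith))
    have h : 0 < t ^ (-p) := Real.rpow_pos_of_pos (by linarith) _
    exact mul_lt_mul_of_pos_right (by linarith) hpos
  · refine (hupp' t (by linarith)).trans_lt ?_
    have h : 0 < t ^ (-p) := Real.rpow_pos_of_pos (by linarith) _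
    exact mul_lt_mul_of_pos_right (by linarith) hpos
  · rcases le_total t 8 with h8 | h8
    · have h1 : t ^ p ≤ 8 ^ p := Real.rpow_le_rpow ht.le h8 (by linarith)
      have h2 := ENNReal.toReal_mono hfin (hle t)
      have h3 := mul_le_mul h1 h2 ENNReal.toReal_nonneg (by positivity)
      linarith
    · have h1 := mul_le_mul_of_nonneg_left (hupp' t h8) (Real.rpow_nonneg ht.le p)
      have h2 : t ^ p * t ^ (-p) = 1 := by rw [← Real.rpow_add ht, add_neg_cancel, Real.rpow_zero]
      have h3 : t ^ p * (32 * t ^ (-p) * (volume Ω).toReal) = 32 * (volume Ω).toReal := by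
        linear_combination 32 * (volume Ω).toReal * h2
      have h4 : 0 ≤ 8 ^ p * (volume Ω).toReal := by positivity
      linarith
  · refine integrable_of_meas_superlevel_le (a := 32 * (volume Ω).toReal) (c := 8) hmeas
      (fun x => hsNormM_nonneg _) hp (by norm_num) fun t ht => ?_
    rw [hset, mul_right_comm, ENNReal.ofReal_mul' hpos.le, ENNReal.ofReal_toReal hfin]
    exact hupp t ht.le
  · refine lintegral_rpow_eq_top_of_le_meas_superlevel (a := (volume Ω).toReal / 8) (c := 2) hmeas
      (fun x => hsNormM_nonneg _) (by linarith) (by positivity) (by norm_num) fun t ht => ?_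
    rw [hset, div_mul_comm, ENNReal.ofReal_mul' hpos.le, ENNReal.ofReal_toReal hfin]
    exact hlow t ht.le
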